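/- arXiv:2301.05771 — 2 statements merged into one kernel-verified Lean document; each statement's English description precedes it below -/
import Mathlib

section
/- Let A be a commutative noetherian ring, 𝔞 an ideal, x = x_1,…,x_t a sequence of elements of 𝔞, M an A-module, and n a non-negative integer. If Ext_A^i(A/𝔞, H^j(x, M)) is finitely generated for all i ≤ n and all j ≤ n, where H^j(x, M) denotes the j-th Koszul cohomology of M with respect to x, then Ext_A^i(A/𝔞, M) is finitely generated for all i ≤ n. -/
open CategoryTheory Limits

noncomputable section

variable {A : Type} [CommRing A]

/-- The `i`-th term of the Koszul cochain complex `Hom_A(K_•(x), M)`. -/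
abbrev KoszulCochain {t : ℕ} (x : Fin t → A) (M : Type) [AddCommGroup M] [Module A M]
    (i : ℕ) : Type :=
  {s : Finset (Fin t) // s.card = i} → M

/-- The Koszul cochain differential. -/
def koszulD {t : ℕ} (x : Fin t → A) (M : Type) [AddCommGroup M] [Module A M] (i : ℕ) :
    KoszulCochain x M i →ₗ[A] KoszulCochain x M (i + 1) :=
  LinearMap.pi fun s => ∑ j ∈ s.1.attach,
    (((-1 : A) ^ ((s.1.filter (fun k => k < j.1)).card)) * x j.1) •
      (LinearMap.proj
        (⟨s.1.erase j.1, by simp [Finset.card_erase_of_mem j.2, s.2]⟩ :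
          {s : Finset (Fin t) // s.card = i}) :
        KoszulCochain x M i →ₗ[A] M)

/-- The boundaries in degree `i` of the Koszul cochain complex. -/
def koszulBoundary {t : ℕ} (x : Fin t → A) (M : Type) [AddCommGroup M] [Module A M] :
    (i : ℕ) → Submodule A (KoszulCochain x M i)
  | 0 => ⊥
  | j + 1 => LinearMap.range (koszulD x M j)

/-- The `i`-th Koszul cohomology `H^i(x, M)` of `M` with respect to `x`. -/
abbrev KoszulCohomology {t : ℕ} (x : Fin t → A) (M : Type) [AddCommGroup M] [Module A M]
    (i : ℕ) : Type :=
  LinearMap.ker (koszulD x M i) ⧸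
    (koszulBoundary x M i).comap (LinearMap.ker (koszulD x M i)).subtype

/-- `Ext_A^i(A/𝔞, M)` as an `A`-module. -/
abbrev extQuot (𝔞 : Ideal A) (M : Type) [AddCommGroup M] [Module A M] (i : ℕ) : Type :=
  ↥(((_root_.Ext A (ModuleCat A) i).obj
    (Opposite.op (ModuleCat.of A (A ⧸ 𝔞)))).obj (ModuleCat.of A M))

section bridge
open Abelian

lemma extMk_eq_zero_iff_zero {X Y : ModuleCat.{0} A} (R : ProjectiveResolution X)
    (f : R.complex.X 0 ⟶ Y) (hf : R.complex.d 1 0 ≫ f = 0) :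
    R.extMk f 1 rfl hf = 0 ↔ f = 0 := by
  refine ⟨fun h => ?_, fun h => by subst h; simp⟩
  simp only [← R.extEquivCohomologyClass.apply_eq_iff_eq,
    ProjectiveResolution.extEquivCohomologyClass_extMk,
    ProjectiveResolution.extEquivCohomologyClass_zero,
    CochainComplex.HomComplex.CohomologyClass.mk_eq_zero_iff] at h
  rw [CochainComplex.HomComplex.Cocycle.toSingleMk_mem_coboundaries_iff _ _ _ _ _ 1 (by simp)] at h
  obtain ⟨g, hg⟩ := h
  have hz : IsZero (R.cochainComplex.X 1) :=
    R.cochainComplex.isZero_of_isStrictlyLE 0 1 (by simp)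
  have : g = 0 := hz.eq_of_src _ _
  subst this
  rw [comp_zero] at hg
  rw [← cancel_epi (R.cochainComplexXIso (-(0:ℕ)) 0 rfl).hom, ← hg]
  simp

/-- cocycles to Ext -/
def extMkLin {X Y : ModuleCat.{0} A} (R : ProjectiveResolution X) (n p : ℕ) :
    LinearMap.ker (((R.complex.linearYonedaObj A Y).sc' p n (n+1)).g.hom) →ₗ[A] Ext X Y n where
  toFun f := R.extMk (Y := Y) f.1 (n+1) rfl f.2
  map_add' f g := (R.add_extMk _ _ _ _ _ _).symm
  map_smul' r f := by
    obtain ⟨f, hf⟩ := f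
    rw [RingHom.id_apply, Ext.smul_eq_comp_mk₀]
    refine Eq.trans ?_ (R.extMk_comp_mk₀ (Y := Y) f (n+1) rfl hf (r • 𝟙 Y)).symm
    have h : ∀ f : R.complex.X n ⟶ Y, r • f = f ≫ (r • 𝟙 Y) := by
      intro f; simp
    have key : ∀ (g g' : R.complex.X n ⟶ Y) (hg) (hg'), g = g' →
      R.extMk g (n+1) rfl hg = R.extMk g' (n+1) rfl hg' := by
        intro g g' hg hg' h; subst h; rfl
    exact key _ _ _ _ (h f)

lemma extMkLin_surjective {X Y : ModuleCat.{0} A} (R : ProjectiveResolution X) (n p : ℕ) :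
    Function.Surjective (extMkLin (Y := Y) R n p) := fun α => by
  obtain ⟨f, hf, h⟩ := R.extMk_surjective α (n+1) rfl
  exact ⟨⟨f, hf⟩, h⟩

lemma extMkLin_ker {X Y : ModuleCat.{0} A} (R : ProjectiveResolution X) (n p : ℕ)
    (hp : (ComplexShape.up ℕ).prev n = p)  :
    LinearMap.ker (extMkLin (Y := Y) R n p) =
      LinearMap.range (((R.complex.linearYonedaObj A Y).sc' p n (n+1)).moduleCatToCycles) := by
  ext f
  obtain ⟨f, hf⟩ := f
  rcases n with _ | n
  · simp at hp
    subst hp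
    have h1 : (R.complex.linearYonedaObj A Y).d 0 0 = 0 :=
      HomologicalComplex.shape _ _ _ (by simp)
    rw [LinearMap.mem_ker]
    refine (extMk_eq_zero_iff_zero R f hf).trans ⟨fun h => ?_, ?_⟩
    · refine ⟨0, ?_⟩
      rw [map_zero]
      exact Subtype.ext h.symm
    · rintro ⟨g, hg⟩
      have := congrArg Subtype.val hg
      refine this.symm.trans ?_
      change ((R.complex.linearYonedaObj A Y).d 0 0).hom g = _
      rw [h1]; rfl
  · simp at hp
    subst hp
    refine (R.extMk_eq_zero_iff (Y := Y) f (n+2) rfl hf n rfl).trans ⟨?_, ?_⟩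
    · rintro ⟨g, hg⟩
      exact ⟨g, Subtype.ext hg⟩
    · rintro ⟨g, hg⟩
      exact ⟨g, congrArg Subtype.val hg⟩

def extBridge (X Y : ModuleCat.{0} A) (n : ℕ) :
    ((_root_.Ext A (ModuleCat A) n).obj (Opposite.op X)).obj Y ≃ₗ[A] Ext X Y n :=
  let R := projectiveResolution X
  let K := R.complex.linearYonedaObj A Y
  let p := (ComplexShape.up ℕ).prev n
  let e1 := R.isoExt (R := A) n Y
  let e2 : K.homology n ≅ (K.sc' p n (n+1)).homology :=
    ShortComplex.homologyMapIso (K.isoSc' p n (n+1) rfl (by simp))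
  let e3 := (K.sc' p n (n+1)).moduleCatHomologyIso
  (e1 ≪≫ e2 ≪≫ e3).toLinearEquiv.trans
    ((Submodule.quotEquivOfEq _ _ (extMkLin_ker R n p rfl).symm).trans
      ((extMkLin R n p).quotKerEquivOfSurjective (extMkLin_surjective R n p)))
end bridge

section general
open Abelian

lemma finite_of_ker_range [IsNoetherianRing A] {V W : Type} [AddCommGroup V] [AddCommGroup W]
    [Module A V] [Module A W] (f : V →ₗ[A] W) (h1 : Module.Finite A (LinearMap.ker f))
    (h2 : Module.Finite A W) : Module.Finite A V := by
  have : Module.Finite A (LinearMap.range f) := inferInstance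
  have : Module.Finite A (V ⧸ LinearMap.ker f) :=
    Module.Finite.equiv f.quotKerEquivRange.symm
  exact Module.Finite.of_submodule_quotient (LinearMap.ker f)

lemma finite_of_le [IsNoetherianRing A] {V : Type} [AddCommGroup V]
    [Module A V] {S T : Submodule A V} (h : S ≤ T) (h2 : Module.Finite A T) :
    Module.Finite A S :=
  Module.Finite.of_injective (Submodule.inclusion h) (Submodule.inclusion_injective h)

lemma finite_ker_comp [IsNoetherianRing A] {U V W : Type} [AddCommGroup U] [AddCommGroup V]
    [AddCommGroup W] [Module A U] [Module A V] [Module A W] (f : U →ₗ[A] V) (g : V →ₗ[A] W)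
    (h1 : Module.Finite A (LinearMap.ker f)) (h2 : Module.Finite A (LinearMap.ker g)) :
    Module.Finite A (LinearMap.ker (g ∘ₗ f)) := by
  let φ : LinearMap.ker (g ∘ₗ f) →ₗ[A] LinearMap.ker g :=
    (f ∘ₗ (LinearMap.ker (g ∘ₗ f)).subtype).codRestrict _ (fun x => x.2)
  refine finite_of_ker_range φ ?_ h2
  let ψ : LinearMap.ker φ →ₗ[A] LinearMap.ker f :=
    ((LinearMap.ker (g ∘ₗ f)).subtype ∘ₗ (LinearMap.ker φ).subtype).codRestrict _
      (fun x => congrArg Subtype.val x.2)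
  refine Module.Finite.of_injective ψ ?_
  intro a b h
  exact Subtype.ext (Subtype.ext (congrArg (fun u : LinearMap.ker f => u.1) h))

variable (X : ModuleCat.{0} A)

/-- Ext modules -/
abbrev EE (k : ℕ) (N : Type) [AddCommGroup N] [Module A N] : Type :=
  Ext X (ModuleCat.of A N) k

/-- functoriality -/
def EEmap (k : ℕ) {N N' : Type} [AddCommGroup N] [Module A N] [AddCommGroup N'] [Module A N']
    (f : N →ₗ[A] N') : EE X k N →ₗ[A] EE X k N' :=
  Ext.postcompOfLinear (Ext.mk₀ (ModuleCat.ofHom f)) A X (add_zero k)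

variable {N N' N'' : Type} [AddCommGroup N] [Module A N] [AddCommGroup N'] [Module A N']
  [AddCommGroup N''] [Module A N'']

lemma EEmap_apply (k : ℕ) (f : N →ₗ[A] N') (e : EE X k N) :
    EEmap X k f e = e.comp (Ext.mk₀ (ModuleCat.ofHom f)) (add_zero k) := rfl

lemma EEmap_comp (k : ℕ) (f : N →ₗ[A] N') (g : N' →ₗ[A] N'') :
    EEmap X k (g ∘ₗ f) = EEmap X k g ∘ₗ EEmap X k f := by
  ext e
  simp [EEmap_apply, ModuleCat.ofHom_comp, ← Ext.mk₀_comp_mk₀]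

lemma EEmap_id (k : ℕ) : EEmap X k (LinearMap.id : N →ₗ[A] N) = LinearMap.id := by
  ext e
  simp [EEmap_apply]

lemma EEmap_add (k : ℕ) (f g : N →ₗ[A] N') :
    EEmap X k (f + g) = EEmap X k f + EEmap X k g := by
  ext e
  simp [EEmap_apply, ModuleCat.ofHom_add, Ext.mk₀_add]

lemma EEmap_smul (k : ℕ) (r : A) (f : N →ₗ[A] N') :
    EEmap X k (r • f) = r • EEmap X k f := by
  ext e
  have : ModuleCat.ofHom (r • f) = r • ModuleCat.ofHom f := rfl
  rw [LinearMap.smul_apply, EEmap_apply, EEmap_apply, this, Ext.mk₀_smul, Ext.comp_smul]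

/-- as a linear map -/
def EEmapL (k : ℕ) : (N →ₗ[A] N') →ₗ[A] (EE X k N →ₗ[A] EE X k N') where
  toFun := EEmap X k
  map_add' := EEmap_add X k
  map_smul' := EEmap_smul X k

lemma EEmap_sum (k : ℕ) {ι : Type} (s : Finset ι) (f : ι → N →ₗ[A] N') :
    EEmap X k (∑ i ∈ s, f i) = ∑ i ∈ s, EEmap X k (f i) :=
  map_sum (EEmapL X k) f s

/-- elements killing X kill Ext -/
lemma EE_smul_eq_zero (k : ℕ) (r : A) (hr : r • 𝟙 X = 0) (e : EE X k N) : r • e = 0 := by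
  have : r • e = (Ext.mk₀ (r • 𝟙 X)).comp e (zero_add k) := by
    rw [Ext.mk₀_smul, Ext.smul_comp, Ext.mk₀_id_comp]
  rw [this, hr]; simp

lemma EE_pi_finite [IsNoetherianRing A] (k : ℕ) {ι : Type} [Finite ι]
    (h : Module.Finite A (EE X k N)) : Module.Finite A (EE X k (ι → N)) := by
  classical
  have := Fintype.ofFinite ι
  refine Module.Finite.of_injective
    (LinearMap.pi fun i => EEmap X k (LinearMap.proj i : (ι → N) →ₗ[A] N)) ?_
  rw [← LinearMap.ker_eq_bot, LinearMap.ker_eq_bot']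
  intro e he
  have hid : (LinearMap.id : (ι → N) →ₗ[A] (ι → N)) =
      ∑ i, LinearMap.single A (fun _ => N) i ∘ₗ LinearMap.proj i := by
    ext
    simp [LinearMap.sum_apply, Finset.sum_apply, Pi.single_apply]
  have h2 := congrArg (fun φ => EEmap X k φ e) hid
  simp only [EEmap_id, EEmap_sum, EEmap_comp, LinearMap.sum_apply, LinearMap.comp_apply,
    LinearMap.id_apply] at h2
  rw [h2]
  refine Finset.sum_eq_zero fun i _ => ?_
  have := congrFun he i
  simp only [LinearMap.pi_apply, Pi.zero_apply] at this
  rw [this, map_zero]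

lemma EE_of_subsingleton (k : ℕ) [Subsingleton N] : Module.Finite A (EE X k N) := by
  have : Subsingleton (EE X k N) := by
    refine subsingleton_of_forall_eq 0 fun e => ?_
    have h0 : (LinearMap.id : N →ₗ[A] N) = (0 : A) • LinearMap.id := by
      ext; exact Subsingleton.elim _ _
    have := congrArg (fun φ => EEmap X k φ e) h0
    rw [EEmap_smul, EEmap_id, zero_smul] at this
    exact this
  infer_instance

variable (f : N →ₗ[A] N') (g : N' →ₗ[A] N'') (hf : Function.Injective f)
  (hg : Function.Surjective g) (hfg : Function.Exact f g)

include hf hg hfg in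
lemma EE_ses : ∃ h, (ShortComplex.mk (ModuleCat.ofHom f) (ModuleCat.ofHom g) h).ShortExact :=
  ⟨by rw [← ModuleCat.ofHom_comp, hfg.linearMap_comp_eq_zero]; rfl,
    ModuleCat.shortComplex_shortExact _ hfg hf hg⟩

include hf hg hfg in
lemma EE_ker_mid (k : ℕ) (h : Module.Finite A (EE X k N)) :
    Module.Finite A (LinearMap.ker (EEmap X k g)) := by
  obtain ⟨_, hS⟩ := EE_ses f g hf hg hfg
  have : LinearMap.ker (EEmap X k g) = LinearMap.range (EEmap X k f) := by
    refine le_antisymm (fun e he => ?_) ?_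
    · obtain ⟨x, hx⟩ := Ext.covariant_sequence_exact₂ X hS e he
      exact ⟨x, hx⟩
    · rintro _ ⟨x, rfl⟩
      rw [LinearMap.mem_ker, ← LinearMap.comp_apply, ← EEmap_comp, hfg.linearMap_comp_eq_zero]
      have h0 : EEmap X k (0 : N →ₗ[A] N'') = 0 := map_zero (EEmapL X k)
      rw [h0]; rfl
  rw [this]
  infer_instance

include hf hg hfg in
lemma EE_ker_left [IsNoetherianRing A] (k : ℕ) (h : Module.Finite A (EE X k N'')) :
    Module.Finite A (LinearMap.ker (EEmap X (k+1) f)) := by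
  obtain ⟨_, hS⟩ := EE_ses f g hf hg hfg
  refine finite_of_le
    (T := LinearMap.range (Ext.postcompOfLinear hS.extClass A X (rfl : k + 1 = k + 1))) ?_ ?_
  · intro e he
    obtain ⟨x, hx⟩ := Ext.covariant_sequence_exact₁ X hS e he rfl
    exact ⟨x, hx⟩
  · change Module.Finite A (Ext X _ k) at h
    infer_instance

include hf in
lemma EE_ker_zero : Module.Finite A (LinearMap.ker (EEmap X 0 f)) := by
  have : Mono (ModuleCat.ofHom f) := (ModuleCat.mono_iff_injective _).2 hf
  have h : LinearMap.ker (EEmap X 0 f) = ⊥ := by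
    rw [LinearMap.ker_eq_bot]
    exact Ext.postcomp_mk₀_injective_of_mono X (ModuleCat.ofHom f)
  rw [h]; infer_instance

end general

section koszul
variable {t : ℕ} (x : Fin t → A) (M : Type) [AddCommGroup M] [Module A M]

/-- total Koszul differential -/
def totD (g : Finset (Fin t) → M) (s : Finset (Fin t)) : M :=
  ∑ j ∈ s, ((-1 : A) ^ ((s.filter (fun k => k < j)).card) * x j) • g (s.erase j)

variable {M} in
lemma totD_totD (g : Finset (Fin t) → M) (s : Finset (Fin t)) :
    totD x M (totD x M g) s = 0 := by
  unfold totD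
  simp only [Finset.smul_sum, Finset.sum_sigma', smul_smul]
  have key : ∀ j k, j ∈ s → j < k →
      (s.filter (· < k)).card = ((s.erase j).filter (· < k)).card + 1 ∧
      ((s.erase k).filter (· < j)).card = (s.filter (· < j)).card := by
    intro j k hj hjk
    constructor
    · rw [Finset.filter_erase, Finset.card_erase_add_one]
      simp [hj, hjk]
    · rw [Finset.filter_erase, Finset.erase_eq_of_notMem]
      simp [hjk.le]
  refine Finset.sum_involution (fun a _ => ⟨a.2, a.1⟩) ?_ ?_ ?_ ?_
  · rintro ⟨j, k⟩ h
    simp only [Finset.mem_sigma, Finset.mem_erase] at h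
    obtain ⟨hj, hkj, hk⟩ := h
    simp only
    rw [Finset.erase_right_comm, ← add_smul]
    convert zero_smul A _
    rcases lt_or_gt_of_ne hkj with h | h
    · obtain ⟨h1, h2⟩ := key k j hk h
      rw [h1, h2]; ring
    · obtain ⟨h1, h2⟩ := key j k hj h
      rw [h1, h2]; ring
  · rintro ⟨j, k⟩ h _ h2
    simp only [Finset.mem_sigma, Finset.mem_erase] at h
    simp only [Sigma.mk.injEq] at h2
    exact h.2.1 h2.1
  · rintro ⟨j, k⟩ h
    simp only [Finset.mem_sigma, Finset.mem_erase] at h ⊢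
    exact ⟨h.2.2, h.2.1.symm, h.1⟩
  · rintro ⟨j, k⟩ h
    rfl

variable {M} in
lemma koszulD_apply {i : ℕ} (f : KoszulCochain x M i) (s) :
    koszulD x M i f s =
      totD x M (fun u => if h : u.card = i then f ⟨u, h⟩ else 0) s.1 := by
  unfold koszulD totD
  rw [LinearMap.pi_apply, LinearMap.sum_apply, ← Finset.sum_attach s.1]
  refine Finset.sum_congr rfl fun j _ => ?_
  have : (s.1.erase j.1).card = i := by simp [Finset.card_erase_of_mem j.2, s.2]
  simp [this]

lemma koszulD_comp (i : ℕ) : koszulD x M (i+1) ∘ₗ koszulD x M i = 0 := by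
  refine LinearMap.ext fun f => funext fun s => ?_
  rw [LinearMap.comp_apply, koszulD_apply]
  refine Eq.trans ?_ (totD_totD x (fun u => if h : u.card = i then f ⟨u, h⟩ else 0) s.1)
  unfold totD
  refine Finset.sum_congr rfl fun j hj => ?_
  have : (s.1.erase j).card = i + 1 := by simp [Finset.card_erase_of_mem hj, s.2]
  simp only
  rw [dif_pos this, koszulD_apply]
  rfl

variable (X : ModuleCat.{0} A)

lemma EEmap_koszulD (hx : ∀ j, x j • 𝟙 X = 0) (k i : ℕ) :
    EEmap X k (koszulD x M i) = 0 := by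
  have h : koszulD x M i = ∑ j, x j • LinearMap.pi (fun s =>
      if h : j ∈ s.1 then ((-1 : A) ^ ((s.1.filter (fun k => k < j)).card)) •
      (LinearMap.proj
        (⟨s.1.erase j, by simp [Finset.card_erase_of_mem h, s.2]⟩ :
          {s : Finset (Fin t) // s.card = i}) :
        KoszulCochain x M i →ₗ[A] M) else 0) := by
    refine LinearMap.ext fun f => funext fun s => ?_
    simp only [koszulD, LinearMap.pi_apply, LinearMap.sum_apply, LinearMap.smul_apply,
      Finset.sum_apply, Pi.smul_apply]
    rw [← Finset.sum_subset (Finset.subset_univ s.1), ← Finset.sum_attach s.1]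
    · refine Finset.sum_congr rfl fun j _ => ?_
      rw [dif_pos j.2, LinearMap.smul_apply, smul_smul, mul_comm]
    · intro j _ hj
      rw [dif_neg hj]; simp
  rw [h, EEmap_sum]
  refine Finset.sum_eq_zero fun j _ => ?_
  rw [EEmap_smul]
  ext1 e
  exact EE_smul_eq_zero X k _ (hx j) _

/-- The homological argument for an abstract complex `K` with cocycles `Z`, coboundaries `B` and
cohomology `H`. -/
lemma main_abs [IsNoetherianRing A] (K Z B H : ℕ → Type)
    [∀ j, AddCommGroup (K j)] [∀ j, Module A (K j)]
    [∀ j, AddCommGroup (Z j)] [∀ j, Module A (Z j)]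
    [∀ j, AddCommGroup (B j)] [∀ j, Module A (B j)]
    [∀ j, AddCommGroup (H j)] [∀ j, Module A (H j)]
    (iZ : ∀ j, Z j →ₗ[A] K j) (q : ∀ j, K j →ₗ[A] B (j+1))
    (iB : ∀ j, B j →ₗ[A] Z j) (p : ∀ j, Z j →ₗ[A] H j)
    (iZi : ∀ j, Function.Injective (iZ j)) (qs : ∀ j, Function.Surjective (q j))
    (ex1 : ∀ j, Function.Exact (iZ j) (q j))
    (iBi : ∀ j, Function.Injective (iB j)) (ps : ∀ j, Function.Surjective (p j))
    (ex2 : ∀ j, Function.Exact (iB j) (p j)) (hB : Subsingleton (B 0))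
    (hD : ∀ n, EEmap X n (iZ 1 ∘ₗ iB 1 ∘ₗ q 0) = 0)
    (hK : ∀ i j, Module.Finite A (EE X i M) → Module.Finite A (EE X i (K j)))
    (hret : ∀ n, Module.Finite A (EE X n (K 0)) → Module.Finite A (EE X n M)) (n : ℕ)
    (hH : ∀ i ≤ n, ∀ j ≤ n, Module.Finite A (EE X i (H j)))
    (hM : ∀ i < n, Module.Finite A (EE X i M)) : Module.Finite A (EE X n M) := by
  have main_B : ∀ k j, k < n → k + j ≤ n → Module.Finite A (EE X k (B (j+1))) := by
    intro k
    induction k with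
    | zero =>
      intro j hk hj
      refine finite_of_ker_range (EEmap X 0 (iB (j+1))) (EE_ker_zero X _ (iBi _)) ?_
      refine finite_of_ker_range (EEmap X 0 (iZ (j+1))) (EE_ker_zero X _ (iZi _)) ?_
      exact hK _ _ (hM 0 hk)
    | succ k ih =>
      intro j hk hj
      refine finite_of_ker_range (EEmap X (k+1) (iB (j+1)))
        (EE_ker_left X _ _ (iBi _) (ps _) (ex2 _) k (hH k (by omega) (j+1) (by omega))) ?_
      refine finite_of_ker_range (EEmap X (k+1) (iZ (j+1)))
        (EE_ker_left X _ _ (iZi _) (qs _) (ex1 _) k (ih (j+1) (by omega) (by omega))) ?_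
      exact hK _ _ (hM (k+1) hk)
  have hZ : Module.Finite A (EE X n (Z 0)) := by
    refine finite_of_ker_range (EEmap X n (p 0))
      (EE_ker_mid X _ _ (iBi _) (ps _) (ex2 _) n (EE_of_subsingleton X n)) ?_
    exact hH n le_rfl 0 (Nat.zero_le _)
  have h0 : Module.Finite A (LinearMap.ker (EEmap X n (q 0))) :=
    EE_ker_mid X _ _ (iZi _) (qs _) (ex1 _) n hZ
  have h1 : Module.Finite A (LinearMap.ker (EEmap X n (iB 1))) := by
    rcases n with _ | n
    · exact EE_ker_zero X _ (iBi _)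
    · exact EE_ker_left X _ _ (iBi _) (ps _) (ex2 _) n (hH n (by omega) 1 (by omega))
  have h2 : Module.Finite A (LinearMap.ker (EEmap X n (iZ 1))) := by
    rcases n with _ | n
    · exact EE_ker_zero X _ (iZi _)
    · exact EE_ker_left X _ _ (iZi _) (qs _) (ex1 _) n (main_B n 1 (by omega) (by omega))
  have h3 := finite_ker_comp _ _ (finite_ker_comp _ _ h0 h1) h2
  rw [← EEmap_comp, ← EEmap_comp, hD, LinearMap.ker_zero] at h3
  exact hret n (Module.Finite.equiv Submodule.topEquiv)

lemma EE_cochain_zero (n : ℕ) (h : Module.Finite A (EE X n (KoszulCochain x M 0))) :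
    Module.Finite A (EE X n M) := by
  -- `M` is a retract of the degree zero cochains
  have hc : (LinearMap.proj ⟨∅, rfl⟩ : KoszulCochain x M 0 →ₗ[A] M) ∘ₗ
      LinearMap.pi (fun _ => LinearMap.id) = LinearMap.id := rfl
  refine Module.Finite.of_surjective
    (EEmap X n (LinearMap.proj ⟨∅, rfl⟩ : KoszulCochain x M 0 →ₗ[A] M)) fun e => ?_
  refine ⟨EEmap X n (LinearMap.pi (fun _ => LinearMap.id)) e, ?_⟩
  rw [← LinearMap.comp_apply, ← EEmap_comp, hc, EEmap_id]; rfl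

end koszul

section complex
variable (K : ℕ → Type) [∀ j, AddCommGroup (K j)] [∀ j, Module A (K j)]
  (d : ∀ j, K j →ₗ[A] K (j+1)) (Bd : ∀ j, Submodule A (K j))

/-- cocycles -/
abbrev kZ (j : ℕ) := LinearMap.ker (d j)
/-- coboundaries in cocycles -/
abbrev kB (j : ℕ) : Submodule A (kZ K d j) := (Bd j).comap (LinearMap.ker (d j)).subtype

variable (hdd : ∀ j, d (j+1) ∘ₗ d j = 0) (hBd : ∀ j, Bd (j+1) = LinearMap.range (d j))

/-- differential onto coboundaries -/
def kQ (j : ℕ) : K j →ₗ[A] kB K d Bd (j+1) :=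
  ((d j).codRestrict (kZ K d (j+1)) (fun f => LinearMap.congr_fun (hdd j) f)).codRestrict _
    (fun f => by rw [Submodule.mem_comap, hBd]; exact ⟨f, rfl⟩)

lemma kQ_surj (j : ℕ) : Function.Surjective (kQ K d Bd hdd hBd j) := by
  rintro ⟨⟨z, hz⟩, hb⟩
  have hb' := hb
  rw [Submodule.mem_comap, hBd] at hb'
  obtain ⟨f, hf⟩ := hb'
  exact ⟨f, Subtype.ext (Subtype.ext hf)⟩

lemma kQ_exact (j : ℕ) : Function.Exact (kZ K d j).subtype (kQ K d Bd hdd hBd j) := by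
  intro f
  constructor
  · intro h
    exact ⟨⟨f, congrArg (fun u : kB K d Bd (j+1) => u.1.1) h⟩, rfl⟩
  · rintro ⟨z, rfl⟩
    exact Subtype.ext (Subtype.ext z.2)

lemma kB_exact (j : ℕ) : Function.Exact (kB K d Bd j).subtype (kB K d Bd j).mkQ := by
  rw [LinearMap.exact_iff]; simp

lemma kB_zero (h : Bd 0 = ⊥) : Subsingleton (kB K d Bd 0) := by
  refine subsingleton_of_forall_eq 0 fun b => ?_
  have := b.2
  rw [Submodule.mem_comap, h] at this
  exact Subtype.ext (Subtype.ext this)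

include hdd hBd in
lemma main_complex [IsNoetherianRing A] (M : Type) [AddCommGroup M] [Module A M]
    (X : ModuleCat.{0} A) (hB0 : Bd 0 = ⊥) (hD : ∀ n, EEmap X n (d 0) = 0)
    (hK : ∀ i j, Module.Finite A (EE X i M) → Module.Finite A (EE X i (K j)))
    (hret : ∀ n, Module.Finite A (EE X n (K 0)) → Module.Finite A (EE X n M)) (n : ℕ)
    (hH : ∀ i ≤ n, ∀ j ≤ n, Module.Finite A (EE X i
      (LinearMap.ker (d j) ⧸ (Bd j).comap (LinearMap.ker (d j)).subtype)))
    (hM : ∀ i < n, Module.Finite A (EE X i M)) : Module.Finite A (EE X n M) :=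
  main_abs M X K (fun j => kZ K d j) (fun j => kB K d Bd j)
    (fun j => kZ K d j ⧸ kB K d Bd j)
    (fun j => (kZ K d j).subtype) (fun j => kQ K d Bd hdd hBd j)
    (fun j => (kB K d Bd j).subtype) (fun j => (kB K d Bd j).mkQ)
    (fun j => Submodule.subtype_injective _) (kQ_surj K d Bd hdd hBd) (kQ_exact K d Bd hdd hBd)
    (fun j => Submodule.subtype_injective _) (fun j => Submodule.mkQ_surjective _)
    (kB_exact K d Bd)
    (kB_zero K d Bd hB0) hD hK hret n hH hM

end complex

lemma main_step [IsNoetherianRing A] {t : ℕ} (x : Fin t → A)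
    (M : Type) [AddCommGroup M] [Module A M] (X : ModuleCat.{0} A)
    (hx : ∀ j, x j • 𝟙 X = 0) (n : ℕ)
    (H : ∀ i ≤ n, ∀ j ≤ n, Module.Finite A (EE X i (KoszulCohomology x M j)))
    (hM : ∀ i < n, Module.Finite A (EE X i M)) : Module.Finite A (EE X n M) :=
  main_complex (KoszulCochain x M) (koszulD x M) (koszulBoundary x M) (koszulD_comp x M)
    (fun _ => rfl) M X rfl (fun n => EEmap_koszulD x M X hx n 0)
    (fun i _ h => EE_pi_finite X i h) (EE_cochain_zero x M X) n H hM


/-- If `x₁, …, x_t ∈ 𝔞` and `Ext_A^i(A/𝔞, H^j(x, M))` is finitely generated for all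
`i ≤ n` and `j ≤ n`, then `Ext_A^i(A/𝔞, M)` is finitely generated for all `i ≤ n`. -/
theorem stmt4 [IsNoetherianRing A] (𝔞 : Ideal A) {t : ℕ} (x : Fin t → A)
    (hx : ∀ j, x j ∈ 𝔞)
    (M : Type) [AddCommGroup M] [Module A M] (n : ℕ)
    (H : ∀ i ≤ n, ∀ j ≤ n, Module.Finite A (extQuot 𝔞 (KoszulCohomology x M j) i)) :
    ∀ i ≤ n, Module.Finite A (extQuot 𝔞 M i) := by
  have hx' : ∀ j, x j • 𝟙 (ModuleCat.of A (A ⧸ 𝔞)) = 0 := by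
    intro j
    ext
    change x j • (Ideal.Quotient.mk 𝔞 1) = 0
    rw [Algebra.smul_def]
    change Ideal.Quotient.mk 𝔞 (x j) * _ = 0
    rw [Ideal.Quotient.eq_zero_iff_mem.2 (hx j), zero_mul]
  have H' : ∀ i ≤ n, ∀ j ≤ n,
      Module.Finite A (EE (ModuleCat.of A (A ⧸ 𝔞)) i (KoszulCohomology x M j)) := by
    intro i hi j hj
    have := H i hi j hj
    exact Module.Finite.equiv (extBridge _ _ i)
  have main : ∀ i ≤ n, Module.Finite A (EE (ModuleCat.of A (A ⧸ 𝔞)) i M) := by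
    intro i
    induction i using Nat.strong_induction_on with
    | _ i ih =>
      intro hi
      exact main_step x M _ hx' i (fun a ha b hb => H' a (ha.trans hi) b (hb.trans hi))
        (fun a ha => ih a ha (ha.le.trans hi))
  intro i hi
  have := main i hi
  exact Module.Finite.equiv (extBridge _ _ i).symm

end
end

section
/- Let A be a commutative noetherian ring, 𝔞 an ideal, x = x_1,…,x_t ∈ 𝔞, and M an A-module with dim M ≤ 1. If Hom_A(A/𝔞, H^j(x,M)) and Ext_A^1(A/𝔞, H^j(x,M)) are finitely generated for j = 0, 1, then Ext_A^i(A/𝔞, M) is finitely generated for all i ≥ 0. -/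
open CategoryTheory Limits

noncomputable section

variable {A : Type} [CommRing A]

lemma extMk_smul' {X Y : ModuleCat.{0} A} (P : ProjectiveResolution X) (n : ℕ)
    (f : P.complex.X n ⟶ Y) (hf : P.complex.d (n+1) n ≫ f = 0) (r : A) :
    P.extMk (r • f) (n+1) rfl (by simp [hf]) = r • P.extMk f (n+1) rfl hf := by
  rw [Abelian.Ext.smul_eq_comp_mk₀, P.extMk_comp_mk₀]
  simp

lemma extMk_zero_iff {X Y : ModuleCat.{0} A} (P : ProjectiveResolution X)
    (f : P.complex.X 0 ⟶ Y) (hf : P.complex.d 1 0 ≫ f = 0) :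
    P.extMk f 1 rfl hf = 0 ↔ f = 0 := by
  simp only [← P.extEquivCohomologyClass.apply_eq_iff_eq,
    ProjectiveResolution.extEquivCohomologyClass_extMk,
    ProjectiveResolution.extEquivCohomologyClass_zero,
    CochainComplex.HomComplex.CohomologyClass.mk_eq_zero_iff]
  rw [CochainComplex.HomComplex.Cocycle.toSingleMk_mem_coboundaries_iff _ _ _ _ _ 1 (by lia)]
  constructor
  · rintro ⟨g, hg⟩
    have h0 : g = 0 := by
      apply (P.cochainComplex.isZero_of_isStrictlyLE 0 1 (by lia)).eq_of_src
    rw [h0, comp_zero] at hg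
    rw [← cancel_epi (P.cochainComplexXIso (-(0:ℕ)) 0 rfl).hom, comp_zero]
    exact hg.symm
  · rintro rfl
    exact ⟨0, by simp⟩

def cocyc {X : ModuleCat.{0} A} (P : ProjectiveResolution X) (Y : ModuleCat.{0} A) (n : ℕ) :
    Submodule A (P.complex.X n ⟶ Y) :=
  LinearMap.ker (Linear.leftComp A Y (P.complex.d (n+1) n))

lemma mem_cocyc {X : ModuleCat.{0} A} (P : ProjectiveResolution X) (Y : ModuleCat.{0} A) (n : ℕ)
  (f) : f ∈ cocyc P Y n ↔ P.complex.d (n+1) n ≫ f = 0 := Iff.rfl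

def extMkL {X : ModuleCat.{0} A} (P : ProjectiveResolution X) (Y : ModuleCat.{0} A) (n : ℕ) :
    cocyc P Y n →ₗ[A] Abelian.Ext X Y n where
  toFun f := P.extMk f.1 (n+1) rfl ((mem_cocyc P Y n _).1 f.2)
  map_add' f g :=
    (P.add_extMk f.1 g.1 (n+1) rfl ((mem_cocyc P Y n _).1 f.2) ((mem_cocyc P Y n _).1 g.2)).symm
  map_smul' r f := extMk_smul' P n f.1 ((mem_cocyc P Y n _).1 f.2) r

lemma extMkL_surj {X : ModuleCat.{0} A} (P : ProjectiveResolution X) (Y : ModuleCat.{0} A) (n : ℕ) :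
    Function.Surjective (extMkL P Y n) := by
  intro e
  obtain ⟨f, hf, rfl⟩ := P.extMk_surjective e (n+1) rfl
  exact ⟨⟨f, hf⟩, rfl⟩

def cobd {X : ModuleCat.{0} A} (P : ProjectiveResolution X) (Y : ModuleCat.{0} A) (n p : ℕ) :
    Submodule A (cocyc P Y n) :=
  LinearMap.range (((P.complex.linearYonedaObj A Y).sc' p n (n+1)).moduleCatToCycles)

lemma mem_cobd {X : ModuleCat.{0} A} (P : ProjectiveResolution X) (Y : ModuleCat.{0} A) (n p : ℕ)
    (f : cocyc P Y n) :
    f ∈ cobd P Y n p ↔ ∃ g : P.complex.X p ⟶ Y, P.complex.d n p ≫ g = f.1 := by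
  constructor
  · rintro ⟨g, hg⟩
    exact ⟨g, congrArg Subtype.val hg⟩
  · rintro ⟨g, hg⟩
    exact ⟨g, Subtype.ext hg⟩

def rootEquiv {X : ModuleCat.{0} A} (P : ProjectiveResolution X) (Y : ModuleCat.{0} A) (n p : ℕ)
    (hp : (ComplexShape.up ℕ).prev n = p) :
    ↥(((_root_.Ext A (ModuleCat A) n).obj (Opposite.op X)).obj Y) ≃ₗ[A]
    (cocyc P Y n ⧸ cobd P Y n p) :=
  ((P.isoExt n Y) ≪≫ (HomologicalComplex.homologyIsoSc' _ p n (n+1) hp (by simp)) ≪≫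
    ShortComplex.moduleCatHomologyIso _).toLinearEquiv

lemma ker_extMkL {X : ModuleCat.{0} A} (P : ProjectiveResolution X) (Y : ModuleCat.{0} A) (n p : ℕ)
    (hp : (ComplexShape.up ℕ).prev n = p) :
    LinearMap.ker (extMkL P Y n) = cobd P Y n p := by
  ext f
  rw [mem_cobd]
  have h1 : f ∈ LinearMap.ker (extMkL P Y n) ↔
    P.extMk f.1 (n+1) rfl ((mem_cocyc P Y n _).1 f.2) = 0 := Iff.rfl
  rw [h1]
  cases n with
  | zero =>
    rw [extMk_zero_iff]
    simp [eq_comm]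
  | succ n =>
    simp at hp
    subst hp
    rw [P.extMk_eq_zero_iff _ _ _ _ n rfl]

/-- Comparison of the two definitions of `Ext` in Mathlib. -/
def rootExtEquiv (X Y : ModuleCat.{0} A) (n : ℕ) :
    ↥(((_root_.Ext A (ModuleCat A) n).obj (Opposite.op X)).obj Y) ≃ₗ[A] Abelian.Ext X Y n :=
  let P := ProjectiveResolution.of X
  (rootEquiv P Y n _ rfl).trans
   ((Submodule.quotEquivOfEq _ _ (ker_extMkL P Y n _ rfl).symm).trans
    (LinearMap.quotKerEquivOfSurjective _ (extMkL_surj P Y n)))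

section extb
variable (𝔞 : Ideal A)

/-- `Ext^i(A/𝔞, N)`. -/
abbrev EX (N : Type) [AddCommGroup N] [Module A N] (i : ℕ) : Type :=
  Abelian.Ext (ModuleCat.of A (A ⧸ 𝔞)) (ModuleCat.of A N) i

/-- `Ext^i(A/𝔞, N)` is finitely generated. -/
def FE (N : Type) [AddCommGroup N] [Module A N] (i : ℕ) : Prop := Module.Finite A (EX 𝔞 N i)

/-- All `Ext^i(A/𝔞, N)` are finitely generated. -/
def GoodE (N : Type) [AddCommGroup N] [Module A N] : Prop := ∀ i, FE 𝔞 N i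

variable {N₁ N₂ N₃ : Type} [AddCommGroup N₁] [Module A N₁] [AddCommGroup N₂] [Module A N₂]
  [AddCommGroup N₃] [Module A N₃]

lemma extQuot_finite_iff (i : ℕ) : Module.Finite A
  ↥(((_root_.Ext A (ModuleCat A) i).obj
    (Opposite.op (ModuleCat.of A (A ⧸ 𝔞)))).obj (ModuleCat.of A N₁)) ↔ FE 𝔞 N₁ i :=
  Module.Finite.equiv_iff (rootExtEquiv _ _ i)

/-- functoriality -/
def EXmap (f : N₁ →ₗ[A] N₂) (i : ℕ) : EX 𝔞 N₁ i →ₗ[A] EX 𝔞 N₂ i :=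
  (Abelian.Ext.mk₀ (ModuleCat.ofHom f)).postcompOfLinear A _ (add_zero i)

lemma EXmap_comp (f : N₁ →ₗ[A] N₂) (g : N₂ →ₗ[A] N₃) (i : ℕ) (e : EX 𝔞 N₁ i) :
    EXmap 𝔞 (g ∘ₗ f) i e = EXmap 𝔞 g i (EXmap 𝔞 f i e) := by
  change e.comp _ (add_zero i) = (e.comp _ (add_zero i)).comp _ (add_zero i)
  rw [Abelian.Ext.comp_assoc_of_second_deg_zero, Abelian.Ext.mk₀_comp_mk₀]
  rfl

lemma EXmap_id (i : ℕ) (e : EX 𝔞 N₁ i) :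
    EXmap 𝔞 (LinearMap.id) i e = e := by
  change e.comp _ (add_zero i) = e
  exact Abelian.Ext.comp_mk₀_id e

lemma EXmap_smul (x : A) (i : ℕ) (e : EX 𝔞 N₁ i) :
    EXmap 𝔞 (x • LinearMap.id) i e = x • e := by
  rw [Abelian.Ext.smul_eq_comp_mk₀]
  rfl

lemma EX_smul_zero (x : A) (hx : x ∈ 𝔞) (i : ℕ) (e : EX 𝔞 N₁ i) : x • e = 0 := by
  have h1 : x • e = (x • Abelian.Ext.mk₀ (𝟙 (ModuleCat.of A (A ⧸ 𝔞)))).comp e (zero_add i) := by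
    rw [Abelian.Ext.smul_comp, Abelian.Ext.mk₀_id_comp]
  have h2 : x • (𝟙 (ModuleCat.of A (A ⧸ 𝔞))) = 0 := by
    apply ModuleCat.hom_ext
    apply LinearMap.ext
    intro y
    obtain ⟨y, rfl⟩ := Ideal.Quotient.mk_surjective y
    change x • (Ideal.Quotient.mk 𝔞 y) = 0
    rw [← Ideal.Quotient.mkₐ_eq_mk A, ← map_smul]
    exact Ideal.Quotient.eq_zero_iff_mem.2 (𝔞.mul_mem_right _ hx)
  rw [h1, ← Abelian.Ext.mk₀_smul, h2, Abelian.Ext.mk₀_zero, Abelian.Ext.zero_comp]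

lemma les_aux1 {X : ModuleCat.{0} A} {S : ShortComplex (ModuleCat.{0} A)} (hS : S.ShortExact) (i : ℕ)
    (e : Abelian.Ext X S.X₂ i) :
    (e.comp (Abelian.Ext.mk₀ S.g) (add_zero i)).comp hS.extClass rfl = (0 : Abelian.Ext X S.X₁ (i+1)) := by
  rw [Abelian.Ext.comp_assoc_of_second_deg_zero, hS.comp_extClass, Abelian.Ext.comp_zero]

lemma les_aux2 {X : ModuleCat.{0} A} {S : ShortComplex (ModuleCat.{0} A)} (hS : S.ShortExact) (i : ℕ)
    (e : Abelian.Ext X S.X₃ i) :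
    (e.comp hS.extClass rfl).comp (Abelian.Ext.mk₀ S.f) (add_zero (i+1)) = (0 : Abelian.Ext X S.X₂ (i+1)) := by
  rw [Abelian.Ext.comp_assoc_of_third_deg_zero, hS.extClass_comp, Abelian.Ext.comp_zero]

variable {f : N₁ →ₗ[A] N₂} {g : N₂ →ₗ[A] N₃} (hf : Function.Injective f)
  (hfg : Function.Exact f g) (hg : Function.Surjective g)

include hf hfg hg in
lemma EX_les :
    ∃ δ : ∀ i, EX 𝔞 N₃ i →ₗ[A] EX 𝔞 N₁ (i+1),
     (∀ i, Function.Exact (EXmap 𝔞 f i) (EXmap 𝔞 g i)) ∧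
     (∀ i, Function.Exact (EXmap 𝔞 g i) (δ i)) ∧
     (∀ i, Function.Exact (δ i) (EXmap 𝔞 f (i+1))) := by
  let S : ShortComplex (ModuleCat.{0} A) := ShortComplex.moduleCatMk f g hfg.linearMap_comp_eq_zero
  have hS : S.ShortExact := ModuleCat.shortComplex_shortExact S hfg hf hg
  refine ⟨fun i => hS.extClass.postcompOfLinear A _ rfl, fun i => ?_, fun i => ?_, fun i => ?_⟩
  · intro e
    refine ⟨fun he => Abelian.Ext.covariant_sequence_exact₂ _ hS e he, ?_⟩
    rintro ⟨e, rfl⟩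
    rw [← EXmap_comp, hfg.linearMap_comp_eq_zero]
    change e.comp (Abelian.Ext.mk₀ 0) (add_zero i) = 0
    simp
  · intro e
    refine ⟨fun he => Abelian.Ext.covariant_sequence_exact₃ _ hS e rfl he, ?_⟩
    rintro ⟨e, rfl⟩
    exact les_aux1 hS i e
  · intro e
    refine ⟨fun he => Abelian.Ext.covariant_sequence_exact₁ _ hS e he rfl, ?_⟩
    rintro ⟨e, rfl⟩
    exact les_aux2 hS i e

lemma EXmap_zero_injective (hf : Function.Injective f) : Function.Injective (EXmap 𝔞 f 0) := by
  have : Mono (ModuleCat.ofHom f) := (ModuleCat.mono_iff_injective _).2 hf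
  exact Abelian.Ext.postcomp_mk₀_injective_of_mono _ (ModuleCat.ofHom f)

lemma finite_of_exact [IsNoetherianRing A] {E₁ E₂ E₃ : Type} [AddCommGroup E₁] [Module A E₁]
    [AddCommGroup E₂] [Module A E₂] [AddCommGroup E₃] [Module A E₃] {u : E₁ →ₗ[A] E₂}
    {v : E₂ →ₗ[A] E₃} (h : Function.Exact u v) [Module.Finite A E₁] [Module.Finite A E₃] :
    Module.Finite A E₂ := by
  have : Module.Finite A (LinearMap.ker v) := by
    rw [h.linearMap_ker_eq]
    exact Module.Finite.range u
  have : Module.Finite A (E₂ ⧸ LinearMap.ker v) :=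
    Module.Finite.equiv v.quotKerEquivRange.symm
  exact Module.Finite.of_submodule_quotient (LinearMap.ker v)

variable [IsNoetherianRing A] {𝔞}

include hf hfg hg in
lemma FE_mid {i : ℕ} (h1 : FE 𝔞 N₁ i) (h3 : FE 𝔞 N₃ i) : FE 𝔞 N₂ i := by
  obtain ⟨δ, h, -, -⟩ := EX_les 𝔞 hf hfg hg
  unfold FE at *
  exact finite_of_exact (h i)

include hf hfg hg in
lemma FE_left {i : ℕ} (h1 : FE 𝔞 N₃ i) (h3 : FE 𝔞 N₂ (i+1)) : FE 𝔞 N₁ (i+1) := by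
  obtain ⟨δ, -, -, h⟩ := EX_les 𝔞 hf hfg hg
  unfold FE at *
  exact finite_of_exact (h i)

include hf hfg hg in
lemma FE_right {i : ℕ} (h1 : FE 𝔞 N₂ i) (h3 : FE 𝔞 N₁ (i+1)) : FE 𝔞 N₃ i := by
  obtain ⟨δ, -, h, -⟩ := EX_les 𝔞 hf hfg hg
  unfold FE at *
  exact finite_of_exact (h i)

lemma FE_left0 (hf : Function.Injective f) (h : FE 𝔞 N₂ 0) : FE 𝔞 N₁ 0 := by
  unfold FE at *
  exact Module.Finite.of_injective _ (EXmap_zero_injective 𝔞 hf)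

lemma GoodE_of_finite [Module.Finite A N₁] : GoodE 𝔞 N₁ := by
  intro i
  unfold FE
  infer_instance

omit [IsNoetherianRing A] in
lemma GoodE_of_bijective {x : A} (hx : x ∈ 𝔞)
    (hb : Function.Bijective (fun n : N₁ => x • n)) : GoodE 𝔞 N₁ := by
  intro i
  have : Subsingleton (EX 𝔞 N₁ i) := by
    refine subsingleton_of_forall_eq 0 fun e => ?_
    let φ : N₁ ≃ₗ[A] N₁ := LinearEquiv.ofBijective (x • LinearMap.id) hb
    have h1 : EXmap 𝔞 (φ.symm.toLinearMap ∘ₗ φ.toLinearMap) i e = 0 := by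
      have : EXmap 𝔞 φ.toLinearMap i e = 0 :=
        (EXmap_smul 𝔞 x i e).trans (EX_smul_zero 𝔞 x hx i e)
      rw [EXmap_comp, this, map_zero]
    rwa [LinearEquiv.symm_comp, EXmap_id] at h1
  unfold FE
  infer_instance

omit [IsNoetherianRing A] in
lemma GoodE_of_subsingleton [Subsingleton N₁] : GoodE 𝔞 N₁ :=
  GoodE_of_bijective (zero_mem 𝔞) ⟨fun _ _ _ => Subsingleton.elim _ _, fun _ => ⟨0, Subsingleton.elim _ _⟩⟩

lemma FE_equiv (e : N₁ ≃ₗ[A] N₂) {i : ℕ} (h : FE 𝔞 N₁ i) : FE 𝔞 N₂ i := by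
  have : Function.Exact (e : N₁ →ₗ[A] N₂) (0 : N₂ →ₗ[A] PUnit.{1}) := by
    intro y
    simp
  exact FE_mid e.injective this (fun y => ⟨0, Subsingleton.elim _ _⟩) h (GoodE_of_subsingleton i)

/-- The multiplication trick. -/
lemma GoodE_trick {x : A} (hx : x ∈ 𝔞) (φ : N₁ →ₗ[A] N₁) (hφ : φ = x • LinearMap.id)
    (h1 : GoodE 𝔞 (LinearMap.ker φ)) (h2 : GoodE 𝔞 (N₁ ⧸ LinearMap.range φ)) :
    GoodE 𝔞 N₁ := by
  intro i
  obtain ⟨δ, hA, -, -⟩ := EX_les 𝔞 (f := (LinearMap.ker φ).subtype) (g := φ.rangeRestrict)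
    (Submodule.subtype_injective _) (by
      rw [LinearMap.exact_iff, LinearMap.ker_rangeRestrict, Submodule.range_subtype])
      φ.surjective_rangeRestrict
  obtain ⟨δ', -, -, hB⟩ := EX_les 𝔞 (f := (LinearMap.range φ).subtype)
    (g := (LinearMap.range φ).mkQ) (Submodule.subtype_injective _) (by
      rw [LinearMap.exact_iff, Submodule.range_subtype, Submodule.ker_mkQ])
      (Submodule.mkQ_surjective _)
  have hz : ∀ e : EX 𝔞 N₁ i, EXmap 𝔞 (LinearMap.range φ).subtype i (EXmap 𝔞 φ.rangeRestrict i e) = 0 := by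
    intro e
    rw [← EXmap_comp]
    have : (LinearMap.range φ).subtype ∘ₗ φ.rangeRestrict = x • LinearMap.id := by
      rw [← hφ]; rfl
    rw [this, EXmap_smul, EX_smul_zero 𝔞 x hx]
  have hk : Module.Finite A (LinearMap.ker (EXmap 𝔞 (LinearMap.range φ).subtype i)) := by
    cases i with
    | zero =>
      rw [LinearMap.ker_eq_bot.2 (EXmap_zero_injective 𝔞 (Submodule.subtype_injective _))]
      infer_instance
    | succ i =>
      rw [(hB i).linearMap_ker_eq]
      have := h2 i
      unfold FE at this
      infer_instance
  let v := (EXmap 𝔞 φ.rangeRestrict i).codRestrict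
    (LinearMap.ker (EXmap 𝔞 (LinearMap.range φ).subtype i)) (fun e => hz e)
  have hv : Function.Exact (EXmap 𝔞 (LinearMap.ker φ).subtype i) v := by
    intro e
    rw [← hA i e]
    exact Subtype.ext_iff
  have := h1 i
  unfold FE at *
  exact finite_of_exact hv
end extb

section artin
set_option linter.unusedSectionVars false
open MvPolynomial
variable {R S K : Type*} [CommRing R] [AddCommGroup S] [Module R S] [Field K] [Algebra R K]
  {n : ℕ} (y : Fin n → R) {ι : Type*} [Fintype ι] (V : Submodule R S) (Ψ : V →ₗ[R] (ι → K))

/-- monomials -/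
noncomputable def ymon (α : Fin n →₀ ℕ) : R := α.prod fun j e => y j ^ e

lemma ymon_add (α β : Fin n →₀ ℕ) : ymon y (α + β) = ymon y α * ymon y β :=
  Finsupp.prod_add_index' (by simp) (by intros; rw [pow_add])

lemma ymon_single (j : Fin n) : ymon y (Finsupp.single j 1) = y j := by
  simp [ymon]

lemma ymon_zero : ymon y 0 = 1 := by simp [ymon]

/-- the elements killed by all monomials of degree `d` -/
def Sfil (S : Type*) [AddCommGroup S] [Module R S] (d : ℕ) : Submodule R S where
  carrier := {s | ∀ α : Fin n →₀ ℕ, α.degree = d → ymon y α • s = 0}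
  zero_mem' := by simp
  add_mem' := by
    intro a b ha hb α h
    rw [smul_add, ha α h, hb α h, add_zero]
  smul_mem' := by
    intro r a ha α h
    rw [smul_comm, ha α h, smul_zero]

lemma Sfil_smul {d : ℕ} {s : S} (hs : s ∈ Sfil y S (d+1)) (j : Fin n) : y j • s ∈ Sfil y S d := by
  intro α h
  rw [smul_smul, ← ymon_single y j, ← ymon_add]
  exact hs _ (by simp [h])

lemma Sfil_mem {d : ℕ} {s : S} (hs : s ∈ Sfil y S (d+1)) (α : Fin n →₀ ℕ) (h : α.degree = d)
  (hV : ∀ s : S, (∀ j, y j • s = 0) → s ∈ V) :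
    ymon y α • s ∈ V := by
  apply hV
  intro j
  rw [smul_smul, ← ymon_single y j, ← ymon_add]
  exact hs _ (by simp [h, add_comm])

open Classical in
/-- extension by zero -/
noncomputable def psi (s : S) : ι → K := if h : s ∈ V then Ψ ⟨s, h⟩ else 0

lemma psi_of_mem {s : S} (h : s ∈ V) : psi V Ψ s = Ψ ⟨s, h⟩ := by
  simp [psi, h]

/-- the pairing -/
noncomputable def Lam (d : ℕ) (s : S) (i : ι) : MvPolynomial (Fin n) K →ₗ[K] K :=
  (basisMonomials (Fin n) K).constr K
    (fun α => if α.degree = d then psi V Ψ (ymon y α • s) i else 0)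

lemma Lam_monomial (d : ℕ) (s : S) (i : ι) (α : Fin n →₀ ℕ) (c : K) :
    Lam y V Ψ d s i (monomial α c) = if α.degree = d then c * psi V Ψ (ymon y α • s) i else 0 := by
  have : (monomial α c : MvPolynomial (Fin n) K) = c • basisMonomials (Fin n) K α := by
    simp [smul_monomial]
  rw [this, map_smul, Lam, Module.Basis.constr_basis]
  simp

lemma Lam_zero_X (s : S) (i : ι) (j : Fin n) (f : MvPolynomial (Fin n) K) :
    Lam y V Ψ 0 s i (X j * f) = 0 := by
  induction f using MvPolynomial.induction_on' with
  | monomial α c =>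
    rw [X, monomial_mul, Lam_monomial, if_neg (by simp)]
  | add p q hp hq => rw [mul_add, map_add, hp, hq, add_zero]

lemma Lam_succ_X (d : ℕ) (s : S) (i : ι) (j : Fin n) (f : MvPolynomial (Fin n) K) :
    Lam y V Ψ (d+1) s i (X j * f) = Lam y V Ψ d (y j • s) i f := by
  induction f using MvPolynomial.induction_on' with
  | monomial α c =>
    rw [X, monomial_mul, Lam_monomial, Lam_monomial, smul_smul, add_comm, ymon_add, ymon_single]
    simp
  | add p q hp hq => rw [mul_add, map_add, hp, hq, map_add]

/-- the orthogonal submodule -/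
noncomputable def Jsub (N : Submodule R S) : Submodule (MvPolynomial (Fin n) K) (ι → MvPolynomial (Fin n) K) where
  carrier := {f | ∀ d, ∀ s ∈ N, s ∈ Sfil y S (d+1) → ∑ i, Lam y V Ψ d s i (f i) = 0}
  zero_mem' := by intro d s _ _; simp
  add_mem' := by
    intro f g hf hg d s h1 h2
    simp [Finset.sum_add_distrib, hf d s h1 h2, hg d s h1 h2]
  smul_mem' := by
    intro p
    induction p using MvPolynomial.induction_on with
    | C a =>
      intro f hf d s h1 h2
      have := hf d s h1 h2
      simp [← MvPolynomial.smul_eq_C_mul, ← Finset.mul_sum, this]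
    | add p q hp hq =>
      intro f hf d s h1 h2
      simp only [Pi.smul_apply, add_smul, map_add, Finset.sum_add_distrib]
      have e1 := hp hf d s h1 h2
      have e2 := hq hf d s h1 h2
      simp only [Pi.smul_apply] at e1 e2
      rw [e1, e2, add_zero]
    | mul_X p j hp =>
      intro f hf d s h1 h2
      have key : ∀ i, ((p * X j) • f) i = X j * (p • f) i := by
        intro i
        simp only [Pi.smul_apply, smul_eq_mul]; ring
      simp only [key]
      cases d with
      | zero => simp only [Lam_zero_X, Finset.sum_const_zero]
      | succ d =>
        simp only [Lam_succ_X]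
        exact hp hf d _ (N.smul_mem _ h1) (Sfil_smul y h2 j)

lemma Jsub_anti {N N' : Submodule R S} (h : N' ≤ N) : Jsub y V Ψ N ≤ Jsub y V Ψ N' :=
  fun _ hf d s h1 h2 => hf d s (h h1) h2

/-- the coefficient vector -/
noncomputable def theta (d : ℕ) (hV : ∀ s : S, (∀ j, y j • s = 0) → s ∈ V) :
    Sfil y S (d+1) →ₗ[R] (({α : Fin n →₀ ℕ // α ∈ Finset.univ.finsuppAntidiag d} × ι) → K) where
  toFun s := fun p => psi V Ψ (ymon y p.1.1 • s.1) p.2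
  map_add' s t := by
    funext p
    have hp : p.1.1.degree = d := by
      have := p.1.2; rw [Finset.mem_finsuppAntidiag] at this
      rw [Finsupp.degree_eq_sum]; exact this.1
    have h1 := Sfil_mem y V s.2 p.1.1 hp hV
    have h2 := Sfil_mem y V t.2 p.1.1 hp hV
    have h3 := V.add_mem h1 h2
    simp only [Pi.add_apply, Submodule.coe_add, smul_add]
    rw [psi_of_mem V Ψ h1, psi_of_mem V Ψ h2, psi_of_mem V Ψ h3, ← Pi.add_apply, ← map_add]
    rfl
  map_smul' r s := by
    funext p
    have hp : p.1.1.degree = d := by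
      have := p.1.2; rw [Finset.mem_finsuppAntidiag] at this
      rw [Finsupp.degree_eq_sum]; exact this.1
    have h1 := Sfil_mem y V s.2 p.1.1 hp hV
    have h3 := V.smul_mem r h1
    simp only [Pi.smul_apply, Submodule.coe_smul, RingHom.id_apply]
    rw [smul_comm, psi_of_mem V Ψ h1, psi_of_mem V Ψ h3]
    exact congrFun (map_smul Ψ r ⟨_, h1⟩) p.2

open Classical in
lemma Jsub_inj (hK : Function.Surjective (algebraMap R K)) (hΨ : Function.Injective Ψ)
    (hV : ∀ s : S, (∀ j, y j • s = 0) → s ∈ V)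
    {N N' : Submodule R S} (hJ : Jsub y V Ψ N' ≤ Jsub y V Ψ N) (hle : N' ≤ N) (d : ℕ) :
    ∀ s ∈ N, s ∈ Sfil y S d → s ∈ N' := by
  induction d with
  | zero =>
    intro s _ hs
    have := hs 0 (by simp)
    rw [ymon_zero, one_smul] at this
    rw [this]; exact zero_mem _
  | succ d ih =>
    intro s hsN hs
    let θ := theta y V Ψ d hV
    let W : Submodule K (({α : Fin n →₀ ℕ // α ∈ Finset.univ.finsuppAntidiag d} × ι) → K) :=
      { carrier := {w | ∃ s : Sfil y S (d+1), s.1 ∈ N' ∧ θ s = w}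
        zero_mem' := ⟨0, zero_mem _, map_zero _⟩
        add_mem' := by
          rintro _ _ ⟨a, ha, rfl⟩ ⟨b, hb, rfl⟩
          exact ⟨a + b, add_mem ha hb, map_add _ _ _⟩
        smul_mem' := by
          rintro c _ ⟨a, ha, rfl⟩
          obtain ⟨r, rfl⟩ := hK c
          exact ⟨r • a, N'.smul_mem _ ha, by rw [map_smul, algebraMap_smul]⟩ }
    have hW : θ ⟨s, hs⟩ ∈ W := by
      by_contra hn
      obtain ⟨ℓ, hℓ, hker⟩ := Submodule.exists_le_ker_of_notMem hn
      let f : ι → MvPolynomial (Fin n) K := fun i =>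
        ∑ α : {α : Fin n →₀ ℕ // α ∈ Finset.univ.finsuppAntidiag d}, monomial α.1 (ℓ (Pi.single (α, i) 1))
      have hdeg : ∀ α : {α : Fin n →₀ ℕ // α ∈ Finset.univ.finsuppAntidiag d}, α.1.degree = d := by
        intro α
        have := α.2; rw [Finset.mem_finsuppAntidiag] at this
        rw [Finsupp.degree_eq_sum]; exact this.1
      have hf1 : ∀ s (hs : s ∈ Sfil y S (d+1)), ∑ i, Lam y V Ψ d s i (f i) = ℓ (θ ⟨s, hs⟩) := by
        intro s hs
        rw [LinearMap.pi_apply_eq_sum_univ ℓ, Fintype.sum_prod_type_right]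
        refine Finset.sum_congr rfl fun i _ => ?_
        rw [map_sum]
        refine Finset.sum_congr rfl fun α _ => ?_
        rw [Lam_monomial, if_pos (hdeg α), smul_eq_mul, mul_comm]
        congr 2
        funext j
        simp [Pi.single_apply, eq_comm]
      have hf2 : f ∈ Jsub y V Ψ N' := by
        intro d' s h1 h2
        by_cases hd : d = d'
        · subst hd
          rw [hf1 s h2]
          exact hker ⟨⟨s, h2⟩, h1, rfl⟩
        · refine Finset.sum_eq_zero fun i _ => ?_
          rw [map_sum]
          refine Finset.sum_eq_zero fun α _ => ?_
          rw [Lam_monomial, if_neg]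
          rw [hdeg α]; exact hd
      exact hℓ ((hf1 s hs).symm.trans (hJ hf2 d s hsN hs))
    obtain ⟨s', hs', he⟩ := hW
    have hsub : s - s'.1 ∈ N' := by
      apply ih _ (sub_mem hsN (hle hs'))
      intro α hα
      have hmem := Sfil_mem y V (sub_mem hs s'.2) α hα hV
      have hz : Ψ ⟨_, hmem⟩ = 0 := by
        have h0 : θ (⟨s, hs⟩ - s') = 0 := by rw [map_sub, he, sub_self]
        funext i
        have := congrFun h0 (⟨α, by
          rw [Finset.mem_finsuppAntidiag]
          rw [Finsupp.degree_eq_sum] at hα; exact ⟨hα, Finset.subset_univ _⟩⟩, i)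
        rw [← psi_of_mem V Ψ hmem]
        exact this
      have := hΨ (hz.trans (map_zero Ψ).symm)
      exact congrArg Subtype.val this
    simpa using add_mem hsub hs'

theorem isArtinian_of_socle (hK : Function.Surjective (algebraMap R K)) (hΨ : Function.Injective Ψ)
    (hV : ∀ s : S, (∀ j, y j • s = 0) → s ∈ V) (hnil : ∀ s : S, ∃ d, s ∈ Sfil y S d) :
    IsArtinian R S := by
  have hmono : StrictAnti (Jsub y V Ψ) := by
    intro N' N h
    refine lt_of_le_of_ne (Jsub_anti y V Ψ h.le) fun he => ?_
    apply h.not_ge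
    intro s hs
    obtain ⟨d, hd⟩ := hnil s
    exact Jsub_inj y V Ψ hK hΨ hV he.ge h.le d s hs hd
  have hno : WellFoundedGT (Submodule (MvPolynomial (Fin n) K) (ι → MvPolynomial (Fin n) K)) :=
    inferInstance
  exact ⟨(InvImage.wf (Jsub y V Ψ) hno.wf).mono (fun a b h => hmono h)⟩

lemma exists_Sfil (s : S) (h : ∀ j, ∃ k, y j ^ k • s = 0) : ∃ d, s ∈ Sfil y S d := by
  choose k hk using h
  refine ⟨∑ j, k j + 1, fun α hα => ?_⟩
  have : ∃ j, k j ≤ α j := by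
    by_contra! hn
    rw [Finsupp.degree_eq_sum] at hα
    have := Finset.sum_le_sum (fun j (_ : j ∈ Finset.univ) => (hn j).le)
    lia
  obtain ⟨j, hj⟩ := this
  have : y j ^ k j ∣ ymon y α := by
    refine (pow_dvd_pow _ hj).trans ?_
    rw [ymon, Finsupp.prod_fintype _ _ (by simp)]
    exact Finset.dvd_prod_of_mem (fun j => y j ^ α j) (Finset.mem_univ j)
  obtain ⟨r, hr⟩ := this
  rw [hr, mul_comm, mul_smul, hk j, smul_zero]
end artin

section dsec
set_option linter.unusedSectionVars false

/-- elements killed by `𝔞` -/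
def sox (𝔞 : Ideal A) (N : Type) [AddCommGroup N] [Module A N] : Submodule A N where
  carrier := {n | ∀ y ∈ 𝔞, y • n = 0}
  zero_mem' := by simp
  add_mem' := by
    intro a b ha hb y hy
    rw [smul_add, ha y hy, hb y hy, add_zero]
  smul_mem' := by
    intro r a ha y hy
    rw [smul_comm, ha y hy, smul_zero]

lemma mem_sox {𝔞 : Ideal A} {N : Type} [AddCommGroup N] [Module A N] {n : N} :
    n ∈ sox 𝔞 N ↔ ∀ y ∈ 𝔞, y • n = 0 := Iff.rfl

/-- `Ext^0(A/𝔞,N) = (0:_N 𝔞)` -/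
def homSox (𝔞 : Ideal A) (N : Type) [AddCommGroup N] [Module A N] :
    ((A ⧸ 𝔞) →ₗ[A] N) ≃ₗ[A] sox 𝔞 N where
  toFun f := ⟨f 1, fun y hy => by
    have h : (y • (1 : A ⧸ 𝔞)) = 0 := by
      rw [Algebra.smul_def, mul_one]; exact Ideal.Quotient.eq_zero_iff_mem.2 hy
    rw [← map_smul, h, map_zero]⟩
  map_add' f g := rfl
  map_smul' r f := rfl
  invFun n := Submodule.liftQ 𝔞 (LinearMap.toSpanSingleton A N n.1) (fun y hy => n.2 y hy)
  left_inv f := by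
    apply LinearMap.ext
    intro z
    obtain ⟨z, rfl⟩ := Ideal.Quotient.mk_surjective z
    change z • f 1 = _
    rw [← map_smul, Algebra.smul_def, mul_one]; rfl
  right_inv n := by
    apply Subtype.ext
    change (1 : A) • n.1 = n.1
    exact one_smul _ _

lemma FE_zero_iff {𝔞 : Ideal A} {N : Type} [AddCommGroup N] [Module A N] :
    FE 𝔞 N 0 ↔ (sox 𝔞 N).FG := by
  rw [← Module.Finite.iff_fg]
  exact Module.Finite.equiv_iff
    ((Abelian.Ext.linearEquiv₀ (R := A)).trans (ModuleCat.homLinearEquiv.trans (homSox 𝔞 N)))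

theorem exists_embedding {R : Type*} [CommRing R] (m : Ideal R) [m.IsMaximal] (V : Type*)
    [AddCommGroup V] [Module R V] [Module.Finite R V] (h : ∀ r ∈ m, ∀ v : V, r • v = 0) :
    ∃ (n : ℕ) (Ψ : V →ₗ[R] (Fin n → R ⧸ m)), Function.Injective Ψ := by
  let : Field (R ⧸ m) := Ideal.Quotient.field m
  have ht : Module.IsTorsionBySet R V (m : Set R) := fun v r => h r.1 r.2 v
  let : Module (R ⧸ m) V := ht.module
  have : IsScalarTower R (R ⧸ m) V := ht.isScalarTower
  have : Module.Finite (R ⧸ m) V := Module.Finite.of_restrictScalars_finite R _ _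
  let b := Module.finBasis (R ⧸ m) V
  exact ⟨_, b.equivFun.toLinearMap.restrictScalars R, b.equivFun.injective⟩

theorem isArtinian_of_max {R S : Type*} [CommRing R] [AddCommGroup S] [Module R S]
    (m : Ideal R) [m.IsMaximal] {n : ℕ} (y : Fin n → R) (hy : Ideal.span (Set.range y) = m)
    (V : Submodule R S) (hV : ∀ s : S, (∀ j, y j • s = 0) ↔ s ∈ V)
    [Module.Finite R V] (hnil : ∀ s : S, ∀ j, ∃ k, y j ^ k • s = 0) : IsArtinian R S := by
  let : Field (R ⧸ m) := Ideal.Quotient.field m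
  obtain ⟨N, Ψ, hΨ⟩ := exists_embedding m V (by
    intro r hr v
    rw [← hy] at hr
    have : v.1 ∈ Submodule.torsionBySet R S (Ideal.span (Set.range y) : Set R) := by
      rw [← Submodule.torsionBySet_eq_torsionBySet_span]
      rw [Submodule.mem_torsionBySet_iff]
      rintro ⟨_, ⟨j, rfl⟩⟩
      exact (hV v.1).2 v.2 j
    exact Subtype.ext ((Submodule.mem_torsionBySet_iff _ _).1 this ⟨r, hr⟩))
  exact isArtinian_of_socle (K := R ⧸ m) y V Ψ Ideal.Quotient.mk_surjective hΨ
    (fun s hs => (hV s).1 hs) (fun s => exists_Sfil y s (hnil s))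

variable {M : Type} [AddCommGroup M] [Module A M]

lemma min_nil {q : PrimeSpectrum A} (hq : ∀ r ∈ Module.support A M, r ≤ q → r = q)
    {y : A} (hy : y ∈ q.asIdeal) (m : M) : ∃ s ∉ q.asIdeal, ∃ j : ℕ, s • y ^ j • m = 0 := by
  by_contra! hn
  let T : Submonoid A := q.asIdeal.primeCompl ⊔ Submonoid.powers y
  obtain ⟨r, hr, h1, h2⟩ := Ideal.exists_le_prime_disjoint ((Submodule.span A {m}).annihilator) T (by
    rw [Set.disjoint_left]
    intro a ha haT
    obtain ⟨s, hs, _, ⟨j, rfl⟩, rfl⟩ := Submonoid.mem_sup.1 haT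
    have := (Submodule.mem_annihilator_span_singleton _ _).1 ha
    exact hn s hs j (by rw [smul_smul]; exact this))
  have hle : r ≤ q.asIdeal := by
    intro a ha
    by_contra hc
    exact Set.disjoint_left.1 h2 ha (Submonoid.mem_sup_left (show a ∈ q.asIdeal.primeCompl from hc))
  have hs : (⟨r, hr⟩ : PrimeSpectrum A) ∈ Module.support A M :=
    Module.mem_support_iff_exists_annihilator.2 ⟨m, h1⟩
  have he := hq _ hs hle
  have : y ∈ r := by rw [← he] at hy; exact hy
  exact Set.disjoint_left.1 h2 this (Submonoid.mem_sup_right (Submonoid.mem_powers y))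

section loc
variable [IsNoetherianRing A] {𝔞 : Ideal A} {p : PrimeSpectrum A} 
  (hp : ∀ r ∈ Module.support A M, r ≤ p → r = p) (hap : 𝔞 ≤ p.asIdeal)

lemma loc_sox (hap : 𝔞 ≤ p.asIdeal) {n : ℕ} (y : Fin n → A)
    (hy : Ideal.span (Set.range y) = p.asIdeal) (s : LocalizedModule p.asIdeal.primeCompl M)
    (hs : ∀ j, algebraMap A (Localization p.asIdeal.primeCompl) (y j) • s = 0) :
    s ∈ (sox 𝔞 M).localized p.asIdeal.primeCompl := by
  obtain ⟨⟨m, u⟩, rfl⟩ := IsLocalizedModule.mk'_surjective p.asIdeal.primeCompl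
    (LocalizedModule.mkLinearMap p.asIdeal.primeCompl M) s
  simp only [Function.uncurry_apply_pair] at hs ⊢
  have h1 : ∀ j, ∃ t : p.asIdeal.primeCompl, t • y j • m = 0 := by
    intro j
    have := hs j
    rw [algebraMap_smul, ← IsLocalizedModule.mk'_smul, IsLocalizedModule.mk'_eq_zero'] at this
    exact this
  choose t ht using h1
  rw [Submodule.mem_localized']
  refine ⟨(∏ j, t j) • m, ?_, (∏ j, t j) * u, IsLocalizedModule.mk'_cancel_left _ _ _ _⟩
  have : (∏ j, t j) • m ∈ Submodule.torsionBySet A M (Ideal.span (Set.range y) : Set A) := by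
    rw [← Submodule.torsionBySet_eq_torsionBySet_span]
    rw [Submodule.mem_torsionBySet_iff]
    rintro ⟨_, ⟨j, rfl⟩⟩
    rw [← Finset.prod_erase_mul Finset.univ t (Finset.mem_univ j), mul_smul]
    simp only []
    rw [smul_comm, smul_comm (y j) (t j), ht j, smul_zero]
  intro a ha
  exact (Submodule.mem_torsionBySet_iff _ _).1 this ⟨a, by rw [hy]; exact hap ha⟩

include hp in
lemma loc_nil {y : A} (hy : y ∈ p.asIdeal) (s : LocalizedModule p.asIdeal.primeCompl M) :
    ∃ k : ℕ, algebraMap A (Localization p.asIdeal.primeCompl) y ^ k • s = 0 := by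
  obtain ⟨⟨m, u⟩, rfl⟩ := IsLocalizedModule.mk'_surjective p.asIdeal.primeCompl
    (LocalizedModule.mkLinearMap p.asIdeal.primeCompl M) s
  obtain ⟨t, ht, k, hk⟩ := min_nil hp hy m
  refine ⟨k, ?_⟩
  rw [← map_pow, algebraMap_smul]
  simp only [Function.uncurry_apply_pair]
  rw [← IsLocalizedModule.mk'_smul, IsLocalizedModule.mk'_eq_zero']
  exact ⟨⟨t, ht⟩, hk⟩

include hp hap in
theorem loc_artinian (hF : FE 𝔞 M 0) :
    IsArtinian (Localization p.asIdeal.primeCompl) (LocalizedModule p.asIdeal.primeCompl M) := by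
  rw [FE_zero_iff] at hF
  obtain ⟨n, y, hy⟩ := Submodule.fg_iff_exists_fin_generating_family.1 (IsNoetherian.noetherian p.asIdeal)
  let y' := fun j => algebraMap A (Localization p.asIdeal.primeCompl) (y j)
  have hspan : Ideal.span (Set.range y') = IsLocalRing.maximalIdeal (Localization.AtPrime p.asIdeal) := by
    rw [← IsLocalization.AtPrime.map_eq_maximalIdeal p.asIdeal]
    have h1 : Ideal.map (algebraMap A (Localization.AtPrime p.asIdeal)) (Ideal.span (Set.range y)) =
        Ideal.span (Set.range y') := by
      rw [Ideal.map_span, ← Set.range_comp]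
      rfl
    rw [← h1]
    exact congrArg _ hy
  let V : Submodule (Localization p.asIdeal.primeCompl) (LocalizedModule p.asIdeal.primeCompl M) :=
    Submodule.torsionBySet _ _ (Set.range y')
  have hV : ∀ s, (∀ j, y' j • s = 0) ↔ s ∈ V := by
    intro s
    rw [Submodule.mem_torsionBySet_iff]
    constructor
    · rintro h ⟨_, ⟨j, rfl⟩⟩
      exact h j
    · intro h j
      exact h ⟨_, ⟨j, rfl⟩⟩
  have hle : V ≤ (sox 𝔞 M).localized p.asIdeal.primeCompl := by
    intro s hs
    exact loc_sox hap y hy s ((hV s).2 hs)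
  have hfg : ((sox 𝔞 M).localized p.asIdeal.primeCompl).FG := by
    obtain ⟨F, hF⟩ := hF
    rw [← hF, Submodule.localized, Submodule.localized'_span]
    exact Submodule.fg_span (F.finite_toSet.image _)
  have : IsNoetherianRing (Localization p.asIdeal.primeCompl) :=
    IsLocalization.isNoetherianRing p.asIdeal.primeCompl _ inferInstance
  have : Module.Finite (Localization p.asIdeal.primeCompl) V := by
    have := Module.Finite.iff_fg.2 hfg
    exact Module.Finite.of_injective (Submodule.inclusion hle) (Submodule.inclusion_injective hle)
  exact isArtinian_of_max (IsLocalRing.maximalIdeal (Localization.AtPrime p.asIdeal)) y' hspan V hV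
    (fun s j => loc_nil hp (by rw [← hy]; exact Submodule.subset_span ⟨j, rfl⟩) s)

include hp hap in
theorem mem_support_sox (hpM : p ∈ Module.support A M) : p ∈ Module.support A (sox 𝔞 M) := by
  obtain ⟨n, y, hy⟩ := Submodule.fg_iff_exists_fin_generating_family.1 (IsNoetherian.noetherian p.asIdeal)
  let y' := fun j => algebraMap A (Localization p.asIdeal.primeCompl) (y j)
  have hnil : ∀ s : LocalizedModule p.asIdeal.primeCompl M, ∃ d, s ∈ Sfil y' _ d :=
    fun s => exists_Sfil y' s
      (fun j => loc_nil hp (by rw [← hy]; exact Submodule.subset_span ⟨j, rfl⟩) s)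
  rw [Module.mem_support_iff] at hpM ⊢
  obtain ⟨s, hs⟩ := exists_ne (0 : LocalizedModule p.asIdeal.primeCompl M)
  classical
  have hd := Nat.find_spec (hnil s)
  have hmin := fun d => Nat.find_min (hnil s) (m := d)
  set d := Nat.find (hnil s)
  have hv : ∃ v : LocalizedModule p.asIdeal.primeCompl M, v ≠ 0 ∧ ∀ j, y' j • v = 0 := by
    cases hdd : d with
    | zero =>
      exfalso
      rw [hdd] at hd
      have := hd 0 (by simp)
      rw [ymon_zero, one_smul] at this
      exact hs this
    | succ d' =>
      have h1 := hmin d' (by lia)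
      have : ∃ α : Fin n →₀ ℕ, α.degree = d' ∧ ymon y' α • s ≠ 0 := by
        by_contra! hc
        exact h1 hc
      obtain ⟨α, hα, hne⟩ := this
      refine ⟨_, hne, fun j => ?_⟩
      rw [hdd] at hd
      rw [smul_smul, ← ymon_single y' j, ← ymon_add]
      exact hd _ (by simp [hα, add_comm])
  obtain ⟨v, hv0, hv⟩ := hv
  have hmem := loc_sox hap y hy v hv
  have : Nontrivial ((sox 𝔞 M).localized p.asIdeal.primeCompl) :=
    ⟨⟨v, hmem⟩, 0, fun h => hv0 (congrArg Subtype.val h)⟩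
  exact ((sox 𝔞 M).localizedEquiv p.asIdeal.primeCompl).symm.toEquiv.nontrivial

theorem finite_min (hF : FE 𝔞 M 0) : {p : PrimeSpectrum A | p ∈ Module.support A M ∧
    (∀ r ∈ Module.support A M, r ≤ p → r = p) ∧ 𝔞 ≤ p.asIdeal}.Finite := by
  rw [FE_zero_iff] at hF
  have := Module.Finite.iff_fg.2 hF
  have hfin := Ideal.finite_minimalPrimes_of_isNoetherianRing A (Module.annihilator A (sox 𝔞 M))
  refine Set.Finite.of_finite_image (f := PrimeSpectrum.asIdeal) (hfin.subset ?_)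
    (fun a _ b _ h => PrimeSpectrum.ext h)
  rintro _ ⟨p, ⟨h1, h2, h3⟩, rfl⟩
  have hs := mem_support_sox h2 h3 h1
  have hz := Module.support_eq_zeroLocus (R := A) (M := sox 𝔞 M)
  refine ⟨⟨p.2, by rw [hz] at hs; exact hs⟩, ?_⟩
  rintro q ⟨hq, hq2⟩ hle
  have hqs : (⟨q, hq⟩ : PrimeSpectrum A) ∈ Module.support A (sox 𝔞 M) := by
    rw [hz]; exact hq2
  have := h2 _ (Module.support_subset_of_injective _ (Submodule.subtype_injective _) hqs) hle
  rw [← this]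
end loc
end dsec

section esec
set_option linter.unusedSectionVars false
variable [IsNoetherianRing A] {𝔞 : Ideal A} {M : Type} [AddCommGroup M] [Module A M]

lemma exact_sub {N : Type} [AddCommGroup N] [Module A N] (N' : Submodule A N) :
    Function.Exact N'.subtype N'.mkQ := by
  rw [LinearMap.exact_iff, Submodule.range_subtype, Submodule.ker_mkQ]

lemma exact_ker {N L : Type} [AddCommGroup N] [Module A N] [AddCommGroup L] [Module A L]
    (φ : N →ₗ[A] L) : Function.Exact (LinearMap.ker φ).subtype φ.rangeRestrict := by
  rw [LinearMap.exact_iff, LinearMap.ker_rangeRestrict, Submodule.range_subtype]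

lemma notMem_support_quot {N : Type} [AddCommGroup N] [Module A N] (N' : Submodule A N)
    {p : PrimeSpectrum A} (h : ∀ n : N, ∃ r ∉ p.asIdeal, r • n ∈ N') :
    p ∉ Module.support A (N ⧸ N') := by
  rw [Module.notMem_support_iff']
  intro m
  obtain ⟨n, rfl⟩ := N'.mkQ_surjective m
  obtain ⟨r, hr, hn⟩ := h n
  exact ⟨r, hr, by rw [← map_smul]; exact (Submodule.Quotient.mk_eq_zero N').2 hn⟩

/-- the measure -/
def muT (T : Set (PrimeSpectrum A)) {N : Type} [AddCommGroup N] [Module A N] (ι : N →ₗ[A] M) :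
    ∀ p : T, Submodule (Localization p.1.asIdeal.primeCompl)
      (LocalizedModule p.1.asIdeal.primeCompl M) :=
  fun p => (LinearMap.range ι).localized p.1.asIdeal.primeCompl

lemma muT_le (T : Set (PrimeSpectrum A)) {N : Type} [AddCommGroup N] [Module A N] (ι : N →ₗ[A] M)
    (N' : Submodule A N) : muT T (ι ∘ₗ N'.subtype) ≤ muT T ι := by
  intro p s hs
  unfold muT at *
  rw [Submodule.mem_localized'] at *
  obtain ⟨m, hm, u, rfl⟩ := hs
  obtain ⟨n, rfl⟩ := hm
  exact ⟨_, ⟨n.1, rfl⟩, u, rfl⟩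

lemma muT_eq {T : Set (PrimeSpectrum A)} {N : Type} [AddCommGroup N] [Module A N] {ι : N →ₗ[A] M}
    (hι : Function.Injective ι)
    (N' : Submodule A N) (h : ¬ muT T (ι ∘ₗ N'.subtype) < muT T ι) (p : PrimeSpectrum A) (hp : p ∈ T)
    (n : N) : ∃ r ∉ p.asIdeal, r • n ∈ N' := by
  have he : muT T (ι ∘ₗ N'.subtype) = muT T ι := eq_of_le_of_not_lt (muT_le T ι N') h
  have h1 : IsLocalizedModule.mk' (LocalizedModule.mkLinearMap p.asIdeal.primeCompl M) (ι n) (1 : p.asIdeal.primeCompl) ∈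
      muT T ι ⟨p, hp⟩ := by
    unfold muT
    rw [Submodule.mem_localized']
    exact ⟨_, ⟨n, rfl⟩, 1, rfl⟩
  rw [← he] at h1
  unfold muT at h1
  rw [Submodule.mem_localized'] at h1
  obtain ⟨_, ⟨n', rfl⟩, u, hu⟩ := h1
  rw [IsLocalizedModule.mk'_eq_mk'_iff] at hu
  obtain ⟨c, hc⟩ := hu
  refine ⟨c * u, (c * u).2, ?_⟩
  have : (c * u).1 • n = c.1 • n'.1 := by
    apply hι
    rw [map_smul, map_smul]
    simp only [one_smul, Submonoid.smul_def, smul_smul] at hc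
    exact hc
  have h2 : (c.1 * u.1) • n ∈ N' := by
    have h3 : (c.1 * u.1) • n = c.1 • n'.1 := this
    rw [h3]
    exact N'.smul_mem _ n'.2
  exact h2

theorem lemI (T : Set (PrimeSpectrum A)) (hT : T.Finite)
    (hart : ∀ p ∈ T, IsArtinian (Localization p.asIdeal.primeCompl)
      (LocalizedModule p.asIdeal.primeCompl M)) (c : Prop)
    (hres : ∀ (N : Type) [AddCommGroup N] [Module A N] (ι : N →ₗ[A] M), Function.Injective ι →
      ∀ N' : Submodule A N, (∀ p ∈ T, p ∉ Module.support A (N ⧸ N')) →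
      (c ∨ FE 𝔞 (N ⧸ N') 0) → GoodE 𝔞 (N ⧸ N')) :
    ∀ (N : Type) [AddCommGroup N] [Module A N] (ι : N →ₗ[A] M), Function.Injective ι →
      FE 𝔞 N 0 → (c ∨ FE 𝔞 N 1) → GoodE 𝔞 N := by
  have : Finite T := hT
  have hw : ∀ p : T, WellFoundedLT (Submodule (Localization p.1.asIdeal.primeCompl)
      (LocalizedModule p.1.asIdeal.primeCompl M)) := fun p => hart p.1 p.2
  have hW : WellFoundedLT (∀ p : T, Submodule (Localization p.1.asIdeal.primeCompl)
      (LocalizedModule p.1.asIdeal.primeCompl M)) := inferInstance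
  suffices H : ∀ μ : (∀ p : T, Submodule (Localization p.1.asIdeal.primeCompl)
      (LocalizedModule p.1.asIdeal.primeCompl M)),
      ∀ (N : Type) [AddCommGroup N] [Module A N] (ι : N →ₗ[A] M), Function.Injective ι →
      muT T ι = μ → FE 𝔞 N 0 → (c ∨ FE 𝔞 N 1) → GoodE 𝔞 N from
    fun N _ _ ι hι h0 h1 => H _ N ι hι rfl h0 h1
  intro μ
  induction μ using hW.wf.induction with
  | h μ IH =>
  intro N _ _ ι hι hμ h0 h1
  subst hμ
  by_cases hx : ∃ x ∈ 𝔞, muT T (ι ∘ₗ (LinearMap.ker (x • LinearMap.id : N →ₗ[A] N)).subtype) < muT T ι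
  · obtain ⟨x, hx, hlt⟩ := hx
    set φ : N →ₗ[A] N := x • LinearMap.id with hφ
    have hR0 : FE 𝔞 (LinearMap.range φ) 0 := FE_left0 (Submodule.subtype_injective _) h0
    have hK0 : FE 𝔞 (LinearMap.ker φ) 0 := FE_left0 (Submodule.subtype_injective _) h0
    have hK1 : c ∨ FE 𝔞 (LinearMap.ker φ) 1 := h1.imp id fun h =>
      FE_left (Submodule.subtype_injective _) (exact_ker φ) φ.surjective_rangeRestrict hR0 h
    have hK : GoodE 𝔞 (LinearMap.ker φ) :=
      IH _ hlt _ _ (hι.comp (Submodule.subtype_injective _)) rfl hK0 hK1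
    have hR1 : c ∨ FE 𝔞 (LinearMap.range φ) 1 := h1.imp id fun h =>
      FE_right (Submodule.subtype_injective _) (exact_ker φ) φ.surjective_rangeRestrict h (hK 2)
    by_cases hlt' : muT T (ι ∘ₗ (LinearMap.range φ).subtype) < muT T ι
    · have hR : GoodE 𝔞 (LinearMap.range φ) :=
        IH _ hlt' _ _ (hι.comp (Submodule.subtype_injective _)) rfl hR0 hR1
      intro i
      exact FE_mid (Submodule.subtype_injective _) (exact_ker φ) φ.surjective_rangeRestrict (hK i) (hR i)
    · refine GoodE_trick hx φ hφ hK (hres N ι hι _ (fun p hp => ?_) ?_)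
      · exact notMem_support_quot _ (muT_eq hι _ hlt' p hp)
      · exact hR1.imp id fun h => FE_right (Submodule.subtype_injective _) (exact_sub _)
          (Submodule.mkQ_surjective _) h0 h
  · have hs : Module.Finite A (sox 𝔞 N) := Module.Finite.iff_fg.2 (FE_zero_iff.1 h0)
    have hG : GoodE 𝔞 (sox 𝔞 N) := GoodE_of_finite
    have hQ : GoodE 𝔞 (N ⧸ sox 𝔞 N) := by
      refine hres N ι hι _ (fun p hp => notMem_support_quot _ fun n => ?_) (Or.inr ?_)
      · obtain ⟨k, a, ha⟩ := Submodule.fg_iff_exists_fin_generating_family.1 (IsNoetherian.noetherian 𝔞)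
        have haj : ∀ j, a j ∈ 𝔞 := fun j => by rw [← ha]; exact Submodule.subset_span ⟨j, rfl⟩
        have hsj : ∀ j, ∃ r ∉ p.asIdeal, a j • r • n = 0 := by
          intro j
          obtain ⟨r, hr, hn⟩ := muT_eq hι _ (fun h => hx ⟨a j, haj j, h⟩) p hp n
          exact ⟨r, hr, hn⟩
        choose r hr hrn using hsj
        refine ⟨∏ j, r j, ?_, ?_⟩
        · intro hmem
          obtain ⟨j, -, hj⟩ := (Ideal.IsPrime.prod_mem_iff (hp := p.2)).1 hmem
          exact hr j hj
        · have : (∏ j, r j) • n ∈ Submodule.torsionBySet A N (Ideal.span (Set.range a) : Set A) := by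
            rw [← Submodule.torsionBySet_eq_torsionBySet_span]
            rw [Submodule.mem_torsionBySet_iff]
            rintro ⟨_, ⟨j, rfl⟩⟩
            rw [← Finset.prod_erase_mul Finset.univ r (Finset.mem_univ j), mul_smul]
            simp only []
            rw [smul_comm, hrn j, smul_zero]
          intro b hb
          exact (Submodule.mem_torsionBySet_iff _ _).1 this ⟨b, by rw [← ha] at hb; exact hb⟩
      · exact FE_right (Submodule.subtype_injective _) (exact_sub _)
          (Submodule.mkQ_surjective _) h0 (hG 1)
    intro i
    exact FE_mid (Submodule.subtype_injective _) (exact_sub _) (Submodule.mkQ_surjective _) (hG i) (hQ i)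

/-- The localization at powers of `x`. -/
abbrev Lx (x : A) (M : Type) [AddCommGroup M] [Module A M] : Type :=
  LocalizedModule (Submonoid.powers x) M

/-- The localization map. -/
abbrev jx (x : A) (M : Type) [AddCommGroup M] [Module A M] : M →ₗ[A] Lx x M :=
  LocalizedModule.mkLinearMap (Submonoid.powers x) M

lemma Lx_good {x : A} (hx : x ∈ 𝔞) : GoodE 𝔞 (Lx x M) := by
  refine GoodE_of_bijective hx ?_
  have := IsLocalizedModule.map_units (jx x M) ⟨x, Submonoid.mem_powers x⟩
  rw [Module.End.isUnit_iff] at this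
  exact this

lemma support_Qx (x : A) (p : PrimeSpectrum A)
    (hp : p ∈ Module.support A (Lx x M ⧸ LinearMap.range (jx x M))) :
    p ∈ Module.support A M ∧ ∃ r ∈ Module.support A M, r < p := by
  constructor
  · by_contra hn
    rw [Module.notMem_support_iff'] at hn
    refine notMem_support_quot _ (fun l => ?_) hp
    obtain ⟨⟨m, u⟩, rfl⟩ := IsLocalizedModule.mk'_surjective (Submonoid.powers x) (jx x M) l
    obtain ⟨r, hr, hm⟩ := hn m
    refine ⟨r, hr, ?_⟩
    simp only [Function.uncurry_apply_pair]
    rw [← IsLocalizedModule.mk'_smul, hm, IsLocalizedModule.mk'_zero]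
    exact zero_mem _
  · by_contra! hn
    have hmin : ∀ r ∈ Module.support A M, r ≤ p → r = p := fun r hr hle =>
      eq_of_le_of_not_lt hle (hn r hr)
    refine notMem_support_quot _ (fun l => ?_) hp
    obtain ⟨⟨m, u⟩, rfl⟩ := IsLocalizedModule.mk'_surjective (Submonoid.powers x) (jx x M) l
    simp only [Function.uncurry_apply_pair]
    by_cases hxp : x ∈ p.asIdeal
    · obtain ⟨s, hs, j, hj⟩ := min_nil hmin hxp m
      refine ⟨s, hs, ?_⟩
      rw [← IsLocalizedModule.mk'_smul]
      have : IsLocalizedModule.mk' (jx x M) (s • m) u = 0 := by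
        rw [IsLocalizedModule.mk'_eq_zero']
        exact ⟨⟨x ^ j, j, rfl⟩, by rw [Submonoid.smul_def, smul_comm]; exact hj⟩
      rw [this]
      exact zero_mem _
    · refine ⟨u.1, ?_, ⟨m, ?_⟩⟩
      · obtain ⟨k, hk⟩ := u.2
        rw [← hk]
        exact fun h => hxp (p.2.mem_of_pow_mem _ h)
      · exact (IsLocalizedModule.mk'_cancel' (jx x M) m u).symm

lemma support_Gx (x : A) (p : PrimeSpectrum A)
    (hp : p ∈ Module.support A (LinearMap.ker (jx x M))) :
    p ∈ Module.support A M ∧ x ∈ p.asIdeal := by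
  refine ⟨Module.support_subset_of_injective _ (Submodule.subtype_injective _) hp, ?_⟩
  by_contra hn
  refine Module.notMem_support_iff'.2 (fun g => ?_) hp
  have h1 := g.2
  rw [LinearMap.mem_ker, IsLocalizedModule.eq_zero_iff (Submonoid.powers x)] at h1
  obtain ⟨⟨_, k, rfl⟩, hk⟩ := h1
  exact ⟨x ^ k, fun h => hn (p.2.mem_of_pow_mem _ h), Subtype.ext hk⟩

theorem genGood (c : Prop) (D : Set (PrimeSpectrum A))
    (hres : ∀ (Q : Type) [AddCommGroup Q] [Module A Q],
      (∀ p ∈ Module.support A Q, p ∈ D ∧ ∃ r ∈ D, r < p) → (c ∨ FE 𝔞 Q 0) → GoodE 𝔞 Q)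
    (l : List A) : (∀ z ∈ l, z ∈ 𝔞) → ∀ J : Ideal A, 𝔞 ≤ J ⊔ Ideal.span {z | z ∈ l} →
      ∀ (M : Type) [AddCommGroup M] [Module A M], Module.support A M ⊆ D →
      (∀ p ∈ Module.support A M, J ≤ p.asIdeal) → FE 𝔞 M 0 → (c ∨ FE 𝔞 M 1) → GoodE 𝔞 M := by
  induction l with
  | nil =>
    intro _ J hJ M _ _ hD hJp h0 h1
    have hJ' : 𝔞 ≤ J := by simpa using hJ
    refine lemI (M := M) _ (finite_min h0) (fun p hp => loc_artinian hp.2.1 hp.2.2 h0) c ?_ M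
      LinearMap.id Function.injective_id h0 h1
    intro N _ _ ι hι N' hs hc
    refine hres _ (fun p hp => ?_) hc
    have hpM : p ∈ Module.support A M := Module.support_subset_of_injective ι hι
      (Module.support_subset_of_surjective _ N'.mkQ_surjective hp)
    refine ⟨hD hpM, ?_⟩
    by_contra! hn
    exact hs p ⟨hpM, fun r hr hle => eq_of_le_of_not_lt hle (hn r (hD hr)), hJ'.trans (hJp p hpM)⟩ hp
  | cons x l IH =>
    intro hl J hJ M _ _ hD hJp h0 h1
    have hx : x ∈ 𝔞 := hl x (by simp)
    have hL : GoodE 𝔞 (Lx x M) := Lx_good hx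
    have hex := exact_ker (jx x M)
    have hinj := (LinearMap.ker (jx x M)).subtype_injective
    have hsur := (jx x M).surjective_rangeRestrict
    have hR0 : FE 𝔞 (LinearMap.range (jx x M)) 0 := FE_left0 (Submodule.subtype_injective _) (hL 0)
    have hG : GoodE 𝔞 (LinearMap.ker (jx x M)) := by
      refine IH (fun z hz => hl z (by simp [hz])) (J ⊔ Ideal.span {x}) ?_ _
        (fun p hp => hD (support_Gx x p hp).1) ?_ (FE_left0 hinj h0)
        (h1.imp id fun h => FE_left hinj hex hsur hR0 h)
      · refine hJ.trans ?_
        rw [sup_assoc, ← Ideal.span_union]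
        refine sup_le_sup_left (Ideal.span_mono ?_) _
        intro z hz
        simpa using hz
      · intro p hp
        obtain ⟨h2, h3⟩ := support_Gx x p hp
        exact sup_le (hJp p h2) ((Ideal.span_singleton_le_iff_mem _).2 h3)
    have hQ : GoodE 𝔞 (Lx x M ⧸ LinearMap.range (jx x M)) := by
      refine hres _ (fun p hp => ?_) (h1.imp id fun h => ?_)
      · obtain ⟨h2, r, h3, h4⟩ := support_Qx x p hp
        exact ⟨hD h2, r, hD h3, h4⟩
      · exact FE_right (Submodule.subtype_injective _) (exact_sub _) (Submodule.mkQ_surjective _)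
          (hL 0) (FE_right hinj hex hsur h (hG 2))
    intro i
    refine FE_mid hinj hex hsur (hG i) ?_
    cases i with
    | zero => exact hR0
    | succ i =>
      exact FE_left (Submodule.subtype_injective _) (exact_sub _) (Submodule.mkQ_surjective _)
        (hQ i) (hL (i+1))

theorem genGood' (c : Prop)
    (hres : ∀ (Q : Type) [AddCommGroup Q] [Module A Q],
      (∀ p ∈ Module.support A Q, p ∈ Module.support A M ∧ ∃ r ∈ Module.support A M, r < p) →
      (c ∨ FE 𝔞 Q 0) → GoodE 𝔞 Q)
    (h0 : FE 𝔞 M 0) (h1 : c ∨ FE 𝔞 M 1) : GoodE 𝔞 M := by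
  obtain ⟨F, hF⟩ := IsNoetherian.noetherian 𝔞
  refine genGood c (Module.support A M) hres F.toList ?_ ⊥ ?_ M subset_rfl (fun _ _ => bot_le) h0 h1
  · intro z hz
    rw [← hF]
    exact Submodule.subset_span (by simpa using hz)
  · rw [bot_sup_eq]
    apply le_of_eq
    rw [← hF]
    simp only [Finset.mem_toList]
    rfl

theorem goodB (hD : ∀ p ∈ Module.support A M, ∀ q ∈ Module.support A M, ¬ p < q)
    (h0 : FE 𝔞 M 0) : GoodE 𝔞 M := by
  refine genGood' True ?_ h0 (Or.inl trivial)
  intro Q _ _ hQ _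
  have : Module.support A Q = ∅ := by
    rw [Set.eq_empty_iff_forall_notMem]
    intro p hp
    obtain ⟨h1, r, h2, h3⟩ := hQ p hp
    exact hD r h2 p h1 h3
  rw [Module.support_eq_empty_iff] at this
  exact GoodE_of_subsingleton

theorem goodC (hD : ∀ p ∈ Module.support A M, ∀ q ∈ Module.support A M, ∀ r ∈ Module.support A M,
      p < q → ¬ q < r)
    (h0 : FE 𝔞 M 0) (h1 : FE 𝔞 M 1) : GoodE 𝔞 M := by
  refine genGood' False ?_ h0 (Or.inr h1)
  intro Q _ _ hQ hc
  refine goodB ?_ (hc.resolve_left id)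
  intro p hp q hq hlt
  obtain ⟨h2, r, h3, h4⟩ := hQ p hp
  exact hD r h3 p h2 q (hQ q hq).1 h4 hlt
end esec

section fsec
set_option linter.unusedSectionVars false
variable [IsNoetherianRing A] (𝔞 : Ideal A)

/-- `0 → 𝔞 → A → A/𝔞 → 0` -/
def SA : ShortComplex (ModuleCat.{0} A) :=
  ShortComplex.mk (X₁ := ModuleCat.of A 𝔞) (X₂ := ModuleCat.of A A) (X₃ := ModuleCat.of A (A ⧸ 𝔞))
    (ModuleCat.ofHom (Submodule.subtype 𝔞)) (ModuleCat.ofHom (Submodule.mkQ 𝔞))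
    (by
      apply ModuleCat.hom_ext
      exact (exact_sub 𝔞).linearMap_comp_eq_zero)

lemma SA_exact : (SA 𝔞).ShortExact :=
  ModuleCat.shortComplex_shortExact (SA 𝔞) (exact_sub 𝔞) (Submodule.subtype_injective _)
    (Submodule.mkQ_surjective 𝔞)

/-- the extension class -/
def clA : Abelian.Ext (ModuleCat.of A (A ⧸ 𝔞)) (ModuleCat.of A 𝔞) 1 := (SA_exact 𝔞).extClass

lemma clA_comp : (clA 𝔞).comp (Abelian.Ext.mk₀ (ModuleCat.ofHom (Submodule.subtype 𝔞))) (add_zero 1) = 0 :=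
  (SA_exact 𝔞).extClass_comp

lemma clA_surj (N : Type) [AddCommGroup N] [Module A N] (e : EX 𝔞 N 1) :
    ∃ f : 𝔞 →ₗ[A] N, (clA 𝔞).comp (Abelian.Ext.mk₀ (ModuleCat.ofHom f)) (add_zero 1) = e := by
  have hP : Projective (ModuleCat.of A A) := (IsProjective.iff_projective A).1 inferInstance
  have h0 : (Abelian.Ext.mk₀ (ModuleCat.ofHom (Submodule.mkQ 𝔞))).comp e (zero_add 1) = 0 :=
    Abelian.Ext.eq_zero_of_projective (P := ModuleCat.of A A) _
  obtain ⟨x, hx⟩ := Abelian.Ext.contravariant_sequence_exact₃ (SA_exact 𝔞) (ModuleCat.of A N) e h0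
    (add_zero 1)
  obtain ⟨g, rfl⟩ := Abelian.Ext.homEquiv₀.symm.surjective x
  exact ⟨ModuleCat.Hom.hom g, hx⟩

/-- `Hom(𝔞,N) → Ext^1(A/𝔞,N)` -/
def PhiA (N : Type) [AddCommGroup N] [Module A N] : (𝔞 →ₗ[A] N) →ₗ[A] EX 𝔞 N 1 where
  toFun f := (clA 𝔞).comp (Abelian.Ext.mk₀ (ModuleCat.ofHom f)) (add_zero 1)
  map_add' f g := by
    rw [ModuleCat.ofHom_add, Abelian.Ext.mk₀_add, Abelian.Ext.comp_add]
  map_smul' r f := by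
    have : ModuleCat.ofHom (r • f) = r • ModuleCat.ofHom f := rfl
    rw [this, Abelian.Ext.mk₀_smul, Abelian.Ext.comp_smul]
    rfl

lemma PhiA_surj (N : Type) [AddCommGroup N] [Module A N] : Function.Surjective (PhiA 𝔞 N) :=
  clA_surj 𝔞 N

lemma PhiA_comp {N L : Type} [AddCommGroup N] [Module A N] [AddCommGroup L] [Module A L]
    (g : N →ₗ[A] L) (f : 𝔞 →ₗ[A] N) : PhiA 𝔞 L (g ∘ₗ f) = EXmap 𝔞 g 1 (PhiA 𝔞 N f) := by
  change _ = ((clA 𝔞).comp (Abelian.Ext.mk₀ (ModuleCat.ofHom f)) (add_zero 1)).comp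
    (Abelian.Ext.mk₀ (ModuleCat.ofHom g)) (add_zero 1)
  rw [Abelian.Ext.comp_assoc_of_second_deg_zero, Abelian.Ext.mk₀_comp_mk₀]
  rfl

lemma PhiA_res {N : Type} [AddCommGroup N] [Module A N]
    (g : A →ₗ[A] N) : PhiA 𝔞 N (g ∘ₗ Submodule.subtype 𝔞) = 0 := by
  have := PhiA_comp 𝔞 g (Submodule.subtype 𝔞)
  rw [this]
  have h : PhiA 𝔞 A (Submodule.subtype 𝔞) = 0 := clA_comp 𝔞
  rw [h, map_zero]

variable {t : ℕ} (x : Fin t → A) (M : Type) [AddCommGroup M] [Module A M]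

lemma koszulD_zero_apply (c : KoszulCochain x M 0) (j : Fin t) :
    koszulD x M 0 c ⟨{j}, by simp⟩ = x j • c ⟨∅, rfl⟩ := by
  simp only [koszulD, LinearMap.pi_apply, LinearMap.sum_apply, LinearMap.smul_apply,
    LinearMap.proj_apply]
  rw [Finset.sum_eq_single_of_mem (⟨j, by simp⟩ : {k // k ∈ ({j} : Finset (Fin t))}) (by simp)
    (by rintro ⟨b, hb⟩ _ hne; exact absurd (Subtype.ext (by simpa using hb)) hne)]
  have : Finset.filter (fun k => k < j) {j} = ∅ := by
    ext k; simp only [Finset.mem_filter, Finset.mem_singleton]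
    simp; rintro rfl; exact le_rfl
  simp [this]

lemma koszulD_one_apply (c : KoszulCochain x M 1) (i j : Fin t) (hij : i < j) :
    koszulD x M 1 c ⟨{i, j}, Finset.card_pair hij.ne⟩ =
      x i • c ⟨{j}, by simp⟩ - x j • c ⟨{i}, by simp⟩ := by
  simp only [koszulD, LinearMap.pi_apply, LinearMap.sum_apply, LinearMap.smul_apply,
    LinearMap.proj_apply]
  have huniv : ({i, j} : Finset (Fin t)).attach = {⟨i, by simp⟩, ⟨j, by simp⟩} := by
    ext ⟨k, hk⟩
    have hk2 : k = i ∨ k = j := by simpa using hk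
    simp only [Finset.mem_attach, Finset.mem_insert, Finset.mem_singleton, Subtype.mk.injEq, hk2]
  have hne : (⟨i, by simp⟩ : {k // k ∈ ({i, j} : Finset (Fin t))}) ≠ ⟨j, by simp⟩ := by
    intro h; exact hij.ne (congrArg Subtype.val h)
  rw [huniv, Finset.sum_pair hne]
  have h1 : Finset.filter (fun k => k < i) {i, j} = ∅ := by
    ext k
    simp only [Finset.mem_filter, Finset.mem_insert, Finset.mem_singleton, Finset.notMem_empty, iff_false]
    rintro ⟨rfl | rfl, h⟩
    · exact lt_irrefl _ h
    · exact lt_asymm h hij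
  have h2 : Finset.filter (fun k => k < j) {i, j} = {i} := by
    ext k
    simp only [Finset.mem_filter, Finset.mem_insert, Finset.mem_singleton]
    constructor
    · rintro ⟨rfl | rfl, h⟩
      · rfl
      · exact absurd h (lt_irrefl _)
    · rintro rfl; exact ⟨Or.inl rfl, hij⟩
  have h3 : ({i, j} : Finset (Fin t)).erase i = {j} := by
    ext k; simp; grind
  have h4 : ({i, j} : Finset (Fin t)).erase j = {i} := by
    ext k; simp; grind
  simp only [h1, h2, h3, h4]
  simp [sub_eq_add_neg]

/-- elements killed by the `x j` -/
def K0 : Submodule A M where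
  carrier := {m | ∀ j, x j • m = 0}
  zero_mem' := by simp
  add_mem' := by
    intro a b ha hb y
    rw [smul_add, ha y, hb y, add_zero]
  smul_mem' := by
    intro r a ha y
    rw [smul_comm, ha y, smul_zero]

lemma koszul_zero_mem (c : KoszulCochain x M 0) :
    c ∈ LinearMap.ker (koszulD x M 0) ↔ c ⟨∅, rfl⟩ ∈ K0 x M := by
  rw [LinearMap.mem_ker]
  constructor
  · intro h j
    rw [← koszulD_zero_apply, h]; rfl
  · intro h
    funext ⟨s, hs⟩
    obtain ⟨j, rfl⟩ := Finset.card_eq_one.1 hs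
    exact (koszulD_zero_apply x M c j).trans (h j)

/-- `H^0` -/
def H0equiv : KoszulCohomology x M 0 ≃ₗ[A] K0 x M :=
  (Submodule.quotEquivOfEqBot _ (by
    rw [Submodule.eq_bot_iff]
    rintro ⟨c, hc⟩ h
    exact Subtype.ext h)).trans
  { toFun := fun c => ⟨c.1 ⟨∅, rfl⟩, (koszul_zero_mem x M c.1).1 c.2⟩
    map_add' := fun _ _ => rfl
    map_smul' := fun _ _ => rfl
    invFun := fun m => ⟨fun _ => m.1, (koszul_zero_mem x M _).2 m.2⟩
    left_inv := by
      rintro ⟨c, hc⟩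
      apply Subtype.ext
      funext ⟨s, hs⟩
      obtain rfl := Finset.card_eq_zero.1 hs
      rfl
    right_inv := fun m => rfl }

variable {𝔞} (hx : ∀ j, x j ∈ 𝔞)

/-- the cochain of a homomorphism -/
def cochA : (𝔞 →ₗ[A] M) →ₗ[A] KoszulCochain x M 1 where
  toFun f := fun s => ∑ j ∈ s.1, f ⟨x j, hx j⟩
  map_add' f g := by
    funext s; simp [Finset.sum_add_distrib]
  map_smul' r f := by
    funext s; simp [Finset.smul_sum]

lemma cochA_single (f : 𝔞 →ₗ[A] M) (j : Fin t) :
    cochA x M hx f ⟨{j}, by simp⟩ = f ⟨x j, hx j⟩ := by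
  simp [cochA]

lemma swapA (f : 𝔞 →ₗ[A] M) (a b : 𝔞) : a.1 • f b = b.1 • f a := by
  rw [← map_smul, ← map_smul]
  congr 1
  apply Subtype.ext
  exact mul_comm _ _

lemma cochA_mem (f : 𝔞 →ₗ[A] M) : cochA x M hx f ∈ LinearMap.ker (koszulD x M 1) := by
  rw [LinearMap.mem_ker]
  funext ⟨s, hs⟩
  have key : ∀ i j : Fin t, i < j → ∀ h, koszulD x M 1 (cochA x M hx f) ⟨{i, j}, h⟩ = 0 := by
    intro i j hij h
    rw [koszulD_one_apply x M _ i j hij, cochA_single, cochA_single, sub_eq_zero]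
    exact swapA M f ⟨x i, hx i⟩ ⟨x j, hx j⟩
  obtain ⟨i, j, hne, rfl⟩ := Finset.card_eq_two.1 hs
  rcases lt_or_gt_of_ne hne with h | h
  · exact key i j h _
  · have := key j i h (by rw [Finset.pair_comm]; exact hs)
    simp only [Finset.pair_comm j i] at this
    exact this

/-- the map to `H^1` -/
def PsiA : (𝔞 →ₗ[A] M) →ₗ[A] KoszulCohomology x M 1 :=
  (Submodule.mkQ _) ∘ₗ (cochA x M hx).codRestrict _ (cochA_mem x M hx)

lemma PsiA_eq_zero (f : 𝔞 →ₗ[A] M) : PsiA x M hx f = 0 ↔ ∃ m : M, ∀ j, f ⟨x j, hx j⟩ = x j • m := by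
  have : PsiA x M hx f = 0 ↔ cochA x M hx f ∈ LinearMap.range (koszulD x M 0) :=
    Submodule.Quotient.mk_eq_zero _
  rw [this]
  constructor
  · rintro ⟨c, hc⟩
    refine ⟨c ⟨∅, rfl⟩, fun j => ?_⟩
    rw [← koszulD_zero_apply, hc, cochA_single]
  · rintro ⟨m, hm⟩
    refine ⟨fun _ => m, ?_⟩
    funext ⟨s, hs⟩
    obtain ⟨j, rfl⟩ := Finset.card_eq_one.1 hs
    exact (koszulD_zero_apply x M _ j).trans ((hm j).symm.trans (cochA_single x M hx f j).symm)

lemma PsiA_sox (f : 𝔞 →ₗ[A] M) : PsiA x M hx f ∈ sox 𝔞 (KoszulCohomology x M 1) := by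
  intro a ha
  rw [← map_smul, PsiA_eq_zero]
  refine ⟨f ⟨a, ha⟩, fun j => ?_⟩
  exact swapA M f ⟨a, ha⟩ ⟨x j, hx j⟩

include hx in
lemma FE0_of_koszul (h : FE 𝔞 (KoszulCohomology x M 0) 0) : FE 𝔞 M 0 := by
  have h1 : FE 𝔞 (K0 x M) 0 := FE_equiv (H0equiv x M) h
  rw [FE_zero_iff] at *
  have : sox 𝔞 M = (sox 𝔞 (K0 x M)).map (K0 x M).subtype := by
    ext m
    rw [Submodule.mem_map]
    constructor
    · intro hm
      exact ⟨⟨m, fun j => hm _ (hx j)⟩, fun y hy => Subtype.ext (hm y hy), rfl⟩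
    · rintro ⟨m, hm, rfl⟩
      intro y hy
      exact congrArg Subtype.val (hm y hy)
  rw [this]
  exact h1.map _

include hx in
lemma FE1_of_koszul (h01 : FE 𝔞 (KoszulCohomology x M 0) 1)
    (h10 : FE 𝔞 (KoszulCohomology x M 1) 0) : FE 𝔞 M 1 := by
  have h1 : FE 𝔞 (K0 x M) 1 := FE_equiv (H0equiv x M) h01
  rw [FE_zero_iff] at h10
  unfold FE at *
  have hs : Module.Finite A (sox 𝔞 (KoszulCohomology x M 1)) := Module.Finite.iff_fg.2 h10
  have hr : Module.Finite A (LinearMap.range (PsiA x M hx)) := by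
    have hle : LinearMap.range (PsiA x M hx) ≤ sox 𝔞 (KoszulCohomology x M 1) := by
      rintro _ ⟨f, rfl⟩
      exact PsiA_sox x M hx f
    exact Module.Finite.of_injective (Submodule.inclusion hle) (Submodule.inclusion_injective hle)
  have hq : Module.Finite A ((𝔞 →ₗ[A] M) ⧸ LinearMap.ker (PsiA x M hx)) :=
    Module.Finite.equiv (PsiA x M hx).quotKerEquivRange.symm
  let W := (LinearMap.ker (PsiA x M hx)).map (PhiA 𝔞 M)
  have hW : W ≤ LinearMap.range (EXmap 𝔞 (K0 x M).subtype 1) := by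
    rintro _ ⟨f, hf, rfl⟩
    obtain ⟨m, hm⟩ := (PsiA_eq_zero x M hx f).1 hf
    let f' : 𝔞 →ₗ[A] M := f - (LinearMap.toSpanSingleton A M m) ∘ₗ Submodule.subtype 𝔞
    have hf' : ∀ j, f' ⟨x j, hx j⟩ = 0 := by
      intro j
      change f ⟨x j, hx j⟩ - x j • m = 0
      rw [hm, sub_self]
    have hK : ∀ a, f' a ∈ K0 x M := by
      intro a j
      have := swapA M f' ⟨x j, hx j⟩ a
      rw [hf', smul_zero] at this
      exact this
    have he : PhiA 𝔞 M f = PhiA 𝔞 M f' := by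
      rw [map_sub, PhiA_res, sub_zero]
    refine ⟨PhiA 𝔞 (K0 x M) (f'.codRestrict _ hK), ?_⟩
    rw [← PhiA_comp, he]
    rfl
  have hWf : Module.Finite A W :=
    Module.Finite.of_injective (Submodule.inclusion hW) (Submodule.inclusion_injective hW)
  have hQ : Module.Finite A (EX 𝔞 M 1 ⧸ W) := by
    refine Module.Finite.of_surjective
      (Submodule.mapQ (LinearMap.ker (PsiA x M hx)) W (PhiA 𝔞 M) (Submodule.le_comap_map _ _)) ?_
    intro e
    obtain ⟨e, rfl⟩ := W.mkQ_surjective e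
    obtain ⟨f, rfl⟩ := PhiA_surj 𝔞 M e
    exact ⟨Submodule.Quotient.mk f, rfl⟩
  exact Module.Finite.of_submodule_quotient W

lemma dim_le_one (hdim : Order.krullDim ↥(Module.support A M) ≤ 1) :
    ∀ p ∈ Module.support A M, ∀ q ∈ Module.support A M, ∀ r ∈ Module.support A M,
      p < q → ¬ q < r := by
  intro p hp q hq r hr h1 h2
  let s : LTSeries ↥(Module.support A M) :=
    { length := 2
      toFun := ![⟨p, hp⟩, ⟨q, hq⟩, ⟨r, hr⟩]
      step := by
        intro i
        fin_cases i
        · exact h1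
        · exact h2 }
  have := (Order.LTSeries.length_le_krullDim s).trans hdim
  have h3 : ((2 : ℕ) : WithBot ℕ∞) ≤ ((1 : ℕ) : WithBot ℕ∞) := this
  have h4 : (2 : ℕ) ≤ 1 := by exact_mod_cast h3
  lia

theorem stmt5' (hdim : Order.krullDim ↥(Module.support A M) ≤ 1)
    (hx : ∀ j, x j ∈ 𝔞)
    (H : ∀ i ≤ 1, ∀ j ≤ 1, Module.Finite A (extQuot 𝔞 (KoszulCohomology x M j) i)) :
    ∀ i : ℕ, Module.Finite A (extQuot 𝔞 M i) := by
  intro i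
  have H' : ∀ i ≤ 1, ∀ j ≤ 1, FE 𝔞 (KoszulCohomology x M j) i := fun i hi j hj =>
    (extQuot_finite_iff 𝔞 i).1 (H i hi j hj)
  refine (extQuot_finite_iff 𝔞 i).2 ?_
  exact goodC (dim_le_one M hdim) (FE0_of_koszul x M hx (H' 0 (by simp) 0 (by simp)))
    (FE1_of_koszul x M hx (H' 1 le_rfl 0 (by simp)) (H' 0 (by simp) 1 le_rfl)) i
end fsec

/-- If `dim M ≤ 1`, `x₁, …, x_t ∈ 𝔞`, and `Hom_A(A/𝔞, H^j(x,M))`, `Ext_A^1(A/𝔞, H^j(x,M))`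
are finitely generated for `j = 0, 1`, then `Ext_A^i(A/𝔞, M)` is finitely generated
for all `i ≥ 0`. -/
theorem stmt5 [IsNoetherianRing A] (𝔞 : Ideal A) {t : ℕ} (x : Fin t → A)
    (hx : ∀ j, x j ∈ 𝔞)
    (M : Type) [AddCommGroup M] [Module A M]
    (hdim : Order.krullDim ↥(Module.support A M) ≤ 1)
    (H : ∀ i ≤ 1, ∀ j ≤ 1, Module.Finite A (extQuot 𝔞 (KoszulCohomology x M j) i)) :
    ∀ i : ℕ, Module.Finite A (extQuot 𝔞 M i) := by
  exact stmt5' x M hdim hx H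

end
end
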